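/- arXiv:1307.2481 — 3 statements merged into one kernel-verified Lean document; each statement's English description precedes it below -/
import Mathlib

section
/- Let k ≥ 2 be an integer and ε > 0. Define A*_k(Z) = A_k(2Z) − A_k(Z). Then there exists a constant C = C(k,ε) > 0 such that for all real Z ≥ 2 and all real P with Z^{1/k} ≤ P ≤ Z one has |A*_k(Z) − c_k·Z| ≤ C·Z^ε·(P + S), where S is the supremum of N(X,Y,Z) over all real X, Y ≥ 1/2 with X·Y ≥ P/4. -/
/-- A positive integer is `k`-free if it is divisible by `p^k` for no prime `p`. -/
def KFree (k n : ℕ) : Prop := ∀ p : ℕ, p.Prime → ¬ p ^ k ∣ n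

/-- `Acount k Z` is the number of positive integers `n ≤ Z` such that both `n` and
`n+1` are `k`-free. -/
noncomputable def Acount (k : ℕ) (Z : ℝ) : ℕ :=
  {n : ℕ | 0 < n ∧ (n : ℝ) ≤ Z ∧ KFree k n ∧ KFree k (n + 1)}.ncard

/-- `ck k` is the infinite product `∏_p (1 - 2/p^k)` over all primes `p`. -/
noncomputable def ck (k : ℕ) : ℝ := ∏' p : Nat.Primes, (1 - 2 / (p : ℝ) ^ k)

/-- `AstarCount k Z = A_k(2Z) - A_k(Z)`. -/
noncomputable def AstarCount (k : ℕ) (Z : ℝ) : ℝ :=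
  (Acount k (2 * Z) : ℝ) - (Acount k Z : ℝ)

/-- `Ncount k X Y Z` is the number of quadruples `(a,b,x,y)` of positive integers with
`a·x^k − b·y^k = 1`, `X < x ≤ 2X`, `Y < y ≤ 2Y` and `Z < b·y^k ≤ 2Z`. -/
noncomputable def Ncount (k : ℕ) (X Y Z : ℝ) : ℕ :=
  {q : ℕ × ℕ × ℕ × ℕ | 0 < q.1 ∧ 0 < q.2.1 ∧ 0 < q.2.2.1 ∧ 0 < q.2.2.2 ∧
    (q.1 : ℤ) * (q.2.2.1 : ℤ) ^ k - (q.2.1 : ℤ) * (q.2.2.2 : ℤ) ^ k = 1 ∧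
    X < (q.2.2.1 : ℝ) ∧ (q.2.2.1 : ℝ) ≤ 2 * X ∧
    Y < (q.2.2.2 : ℝ) ∧ (q.2.2.2 : ℝ) ≤ 2 * Y ∧
    Z < (q.2.1 : ℝ) * (q.2.2.2 : ℝ) ^ k ∧ (q.2.1 : ℝ) * (q.2.2.2 : ℝ) ^ k ≤ 2 * Z}.ncard

open Finset in
open ArithmeticFunction in
lemma sum_divisors_moebius_eq (n : ℕ) :
    ∑ d ∈ n.divisors, moebius d = if n = 1 then 1 else 0 := by
  rw [← coe_mul_zeta_apply, moebius_mul_coe_zeta, one_apply]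

lemma kFree_iff_floorRoot_eq_one (k n : ℕ) : KFree k n ↔ Nat.floorRoot k n = 1 := by
  simp only [KFree, Nat.pow_dvd_iff_dvd_floorRoot]
  rw [Nat.eq_one_iff_not_exists_prime_dvd]

lemma coprime_floorRoot_succ (k n : ℕ) (hk : k ≠ 0) :
    (Nat.floorRoot k (n + 1)).Coprime (Nat.floorRoot k n) := by
  have h : ((Nat.floorRoot k (n + 1)) ^ k).Coprime ((Nat.floorRoot k n) ^ k) :=
    Nat.Coprime.of_dvd Nat.floorRoot_pow_dvd Nat.floorRoot_pow_dvd
      (by simp)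
  exact Nat.Coprime.coprime_dvd_left (dvd_pow_self _ hk)
    (Nat.Coprime.coprime_dvd_right (dvd_pow_self _ hk) h)

open Finset ArithmeticFunction Classical in
/-- Möbius inversion for the indicator of `n` and `n + 1` both being `k`-free, written as a sum
over the pairs of positive integers up to a large enough bound `M`. -/
lemma kFree_and_kFree_succ_indicator (k n M : ℕ) (hk : k ≠ 0) (hn : 0 < n) (hM : n + 1 ≤ M) :
    (if KFree k n ∧ KFree k (n + 1) then 1 else 0 : ℝ) =
      ∑ p ∈ Icc 1 M ×ˢ Icc 1 M, (moebius (p.1 * p.2) : ℝ) *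
        if p.1 ^ k ∣ n + 1 ∧ p.2 ^ k ∣ n then 1 else 0 := by
  set r := Nat.floorRoot k (n + 1) with hr
  set s := Nat.floorRoot k n with hs
  have hr0 : r ≠ 0 := Nat.floorRoot_ne_zero.2 ⟨hk, by omega⟩
  have hs0 : s ≠ 0 := Nat.floorRoot_ne_zero.2 ⟨hk, by omega⟩
  have hco : r.Coprime s := coprime_floorRoot_succ k n hk
  have hle : ∀ {m x : ℕ}, m ≠ 0 → x ^ k ∣ m → x ≤ m := fun hm hx =>
    Nat.le_of_dvd (Nat.pos_of_ne_zero hm) ((dvd_pow_self _ hk).trans hx)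
  have hfilter : {p ∈ Icc 1 M ×ˢ Icc 1 M | p.1 ^ k ∣ n + 1 ∧ p.2 ^ k ∣ n} =
      r.divisors ×ˢ s.divisors := by
    ext ⟨x, y⟩
    simp only [mem_filter, mem_product, mem_Icc, Nat.mem_divisors, hr, hs,
      ← Nat.pow_dvd_iff_dvd_floorRoot]
    constructor
    · rintro ⟨-, h1, h2⟩
      exact ⟨⟨h1, hr0⟩, h2, hs0⟩
    · rintro ⟨⟨h1, -⟩, h2, -⟩
      have h1' := hle (by omega) h1
      have h2' := hle (by omega) h2
      have hx : x ≠ 0 := by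
        rintro rfl
        simp [hk] at h1
      have hy : y ≠ 0 := by
        rintro rfl
        simp [hk] at h2
        omega
      exact ⟨by omega, h1, h2⟩
  simp only [mul_ite, mul_one, mul_zero]
  rw [← sum_filter, hfilter, sum_product]
  have hmul : ∀ x ∈ r.divisors, ∀ y ∈ s.divisors,
      (moebius (x * y) : ℝ) = moebius x * moebius y := fun x hx y hy => by
    rw [isMultiplicative_moebius.map_mul_of_coprime
      (Nat.Coprime.of_dvd (Nat.dvd_of_mem_divisors hx) (Nat.dvd_of_mem_divisors hy) hco)]
    push_cast
    rfl
  rw [sum_congr rfl fun x hx => sum_congr rfl fun y hy => hmul x hx y hy, ← sum_mul_sum]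
  have h1 : (∑ x ∈ r.divisors, (moebius x : ℝ)) = if r = 1 then 1 else 0 := by
    exact_mod_cast congrArg (Int.cast : ℤ → ℝ) (sum_divisors_moebius_eq r)
  have h2 : (∑ x ∈ s.divisors, (moebius x : ℝ)) = if s = 1 then 1 else 0 := by
    exact_mod_cast congrArg (Int.cast : ℤ → ℝ) (sum_divisors_moebius_eq s)
  rw [h1, h2, kFree_iff_floorRoot_eq_one, kFree_iff_floorRoot_eq_one, ← hr, ← hs]
  by_cases a : r = 1 <;> by_cases b : s = 1 <;> simp [a, b]

open Finset Classical in
lemma astarCount_eq_sum (k : ℕ) (Z : ℝ) (hZ : 0 ≤ Z) :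
    AstarCount k Z =
      ∑ n ∈ Ioc ⌊Z⌋₊ ⌊2 * Z⌋₊, if KFree k n ∧ KFree k (n + 1) then (1 : ℝ) else 0 := by
  have h : ∀ W : ℝ, 0 ≤ W → (Acount k W : ℝ) =
      ∑ n ∈ Ioc 0 ⌊W⌋₊, if KFree k n ∧ KFree k (n + 1) then (1 : ℝ) else 0 := fun W hW => by
    rw [sum_boole, Acount, ← Set.ncard_coe_finset]
    congr 2
    ext n
    simp [Nat.le_floor_iff hW, and_assoc]
  rw [AstarCount, h _ hZ, h _ (by linarith), sub_eq_iff_eq_add', sum_Ioc_consecutive _ (Nat.zero_le _)]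
  exact Nat.floor_le_floor (by linarith)

open Finset in
/-- The number of `n` with `⌊Z⌋ < n ≤ ⌊2Z⌋` such that `x ^ k ∣ n + 1` and `y ^ k ∣ n`. -/
noncomputable def pairCount (k : ℕ) (Z : ℝ) (p : ℕ × ℕ) : ℕ :=
  #{n ∈ Ioc ⌊Z⌋₊ ⌊2 * Z⌋₊ | p.1 ^ k ∣ n + 1 ∧ p.2 ^ k ∣ n}

open Finset ArithmeticFunction in
lemma astarCount_eq_sum_pairCount (k M : ℕ) (Z : ℝ) (hk : k ≠ 0) (hZ : 0 ≤ Z)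
    (hM : ⌊2 * Z⌋₊ + 1 ≤ M) :
    AstarCount k Z =
      ∑ p ∈ Icc 1 M ×ˢ Icc 1 M, (moebius (p.1 * p.2) : ℝ) * pairCount k Z p := by
  rw [astarCount_eq_sum k Z hZ, sum_congr rfl fun n hn => kFree_and_kFree_succ_indicator k n M hk
    (by have := mem_Ioc.1 hn; omega) (by have := mem_Ioc.1 hn; omega), sum_comm]
  refine sum_congr rfl fun p _ => ?_
  rw [← mul_sum, sum_boole, pairCount]

open Finset in
lemma abs_pairCount_sub_le (k : ℕ) (Z : ℝ) (hZ : 0 ≤ Z) (x y : ℕ) (hx : 0 < x) (hy : 0 < y)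
    (hxy : x.Coprime y) :
    |(pairCount k Z (x, y) : ℝ) - Z / ((x * y : ℕ) : ℝ) ^ k| ≤ 2 := by
  have hco : (x ^ k).Coprime (y ^ k) := hxy.pow k k
  obtain ⟨v, hv1, hv2⟩ := Nat.chineseRemainder hco (x ^ k - 1) 0
  set m := (x * y) ^ k with hm
  have hm0 : 0 < m := by positivity
  have hx0 : 0 < x ^ k := by positivity
  have hset : pairCount k Z (x, y) = #{n ∈ Ioc ⌊Z⌋₊ ⌊2 * Z⌋₊ | n ≡ v [MOD m]} := by
    rw [pairCount]
    congr 1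
    refine filter_congr fun n _ => ?_
    rw [hm, mul_pow, ← Nat.modEq_and_modEq_iff_modEq_mul hco]
    refine and_congr ⟨fun h => ?_, fun h => ?_⟩ ⟨fun h => ?_, fun h => ?_⟩
    · refine Nat.ModEq.trans (Nat.ModEq.add_right_cancel' 1 ?_) hv1.symm
      rw [Nat.sub_add_cancel hx0]
      exact ((Nat.modEq_zero_iff_dvd.2 h)).trans (Nat.modEq_zero_iff_dvd.2 dvd_rfl).symm
    · have := (h.trans hv1).add_right 1
      rw [Nat.sub_add_cancel hx0] at this
      exact Nat.modEq_zero_iff_dvd.1 (this.trans (Nat.modEq_zero_iff_dvd.2 dvd_rfl))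
    · exact (Nat.modEq_zero_iff_dvd.2 h).trans hv2.symm
    · exact Nat.modEq_zero_iff_dvd.1 (h.trans hv2)
  have hcard := Nat.Ioc_filter_modEq_card ⌊Z⌋₊ ⌊2 * Z⌋₊ hm0 v
  have hfl : ⌊Z⌋₊ ≤ ⌊2 * Z⌋₊ := Nat.floor_le_floor (by linarith)
  have hmQ : (0 : ℚ) < m := by exact_mod_cast hm0
  rw [max_eq_left (sub_nonneg.2 (Int.floor_le_floor (by gcongr))), ← hset] at hcard
  set a := ((⌊2 * Z⌋₊ : ℚ) - v) / m
  set b := ((⌊Z⌋₊ : ℚ) - v) / m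
  have hab : a - b = ((⌊2 * Z⌋₊ : ℚ) - ⌊Z⌋₊) / m := by
    simp only [a, b]
    ring
  have hcardQ : (pairCount k Z (x, y) : ℚ) = ⌊a⌋ - ⌊b⌋ := by exact_mod_cast hcard
  have key : |(pairCount k Z (x, y) : ℚ) - ((⌊2 * Z⌋₊ : ℚ) - ⌊Z⌋₊) / m| ≤ 1 := by
    rw [← hab, hcardQ, abs_le]
    constructor <;>
      linarith [Int.floor_le a, Int.floor_le b, Int.lt_floor_add_one a, Int.lt_floor_add_one b]
  have key' : |(pairCount k Z (x, y) : ℝ) - ((⌊2 * Z⌋₊ : ℝ) - ⌊Z⌋₊) / m| ≤ 1 := by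
    exact_mod_cast key
  have hm1 : (1 : ℝ) ≤ m := by exact_mod_cast hm0
  have hdiff : |((⌊2 * Z⌋₊ : ℝ) - ⌊Z⌋₊) / m - Z / m| ≤ 1 := by
    rw [← sub_div, abs_div, abs_of_pos (by linarith : (0 : ℝ) < m), div_le_one (by linarith)]
    refine le_trans ?_ hm1
    rw [abs_le]
    constructor <;>
      linarith [Nat.floor_le hZ, Nat.floor_le (by linarith : (0 : ℝ) ≤ 2 * Z),
        Nat.lt_floor_add_one Z, Nat.lt_floor_add_one (2 * Z)]
  have hmc : ((x * y : ℕ) : ℝ) ^ k = m := by rw [hm]; push_cast; rfl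
  rw [hmc]
  calc _ ≤ _ := abs_sub_le _ (((⌊2 * Z⌋₊ : ℝ) - ⌊Z⌋₊) / m) _
    _ ≤ 2 := by linarith

open ArithmeticFunction in
lemma summable_card_divisors_div_rpow {s : ℝ} (hs : 1 < s) :
    Summable fun d : ℕ => (d.divisors.card : ℝ) / (d : ℝ) ^ s := by
  have hz : LSeriesSummable (fun n => (zeta : ArithmeticFunction ℂ) n) (s : ℂ) := by
    have := LSeriesSummable_zeta_iff.2 (show 1 < (s : ℂ).re by simpa using hs)
    simpa using this
  have h := (LSeriesSummable_mul hz hz).norm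
  refine h.congr fun d => ?_
  rcases eq_or_ne d 0 with rfl | hd
  · simp
  · rw [LSeries.term_of_ne_zero hd, norm_div, Complex.norm_natCast_cpow_of_pos (by omega)]
    congr 1
    have : ((zeta : ArithmeticFunction ℂ) * zeta) d = d.divisors.card := by
      rw [coe_mul_zeta_apply, Finset.sum_congr rfl
        (g := fun _ => (1 : ℂ)) fun i hi => by simp [(Nat.pos_of_mem_divisors hi).ne']]
      simp
    rw [this, Complex.norm_natCast]

open ArithmeticFunction in
/-- The coefficients of the Dirichlet-type series whose sum is `ck k`. -/
noncomputable def ckTerm (k d : ℕ) : ℝ :=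
  (moebius d : ℝ) * (d.divisors.card : ℝ) / (d : ℝ) ^ k

open ArithmeticFunction in
lemma abs_ckTerm_le (k d : ℕ) : |ckTerm k d| ≤ (d.divisors.card : ℝ) / (d : ℝ) ^ k := by
  rw [ckTerm, abs_div, abs_mul, Nat.abs_cast, abs_of_nonneg (by positivity : (0 : ℝ) ≤ (d : ℝ) ^ k)]
  gcongr
  have : |(moebius d : ℝ)| ≤ 1 := by exact_mod_cast abs_moebius_le_one
  nlinarith [(Nat.cast_nonneg d.divisors.card : (0 : ℝ) ≤ _)]

lemma summable_abs_ckTerm {k : ℕ} (hk : 2 ≤ k) : Summable fun d => |ckTerm k d| := by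
  refine Summable.of_nonneg_of_le (fun _ => abs_nonneg _) (abs_ckTerm_le k) ?_
  simpa using summable_card_divisors_div_rpow (s := (k : ℝ)) (by exact_mod_cast hk)

open ArithmeticFunction in
lemma tsum_ckTerm {k : ℕ} (hk : 2 ≤ k) : ∑' d, ckTerm k d = ck k := by
  have h := EulerProduct.eulerProduct_hasProd (f := ckTerm k) (by simp [ckTerm])
    (fun {m n} hmn => by
      simp only [ckTerm, isMultiplicative_moebius.map_mul_of_coprime hmn,
        Nat.Coprime.card_divisors_mul hmn]
      push_cast
      rw [mul_pow, div_mul_div_comm]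
      ring)
    (summable_abs_ckTerm hk) (by simp [ckTerm])
  rw [← h.tprod_eq, ck]
  congr 1
  ext p
  rw [tsum_eq_sum (s := Finset.range 2)]
  · have hp : p.1.divisors.card = 2 := by
      rw [p.2.divisors, Finset.card_pair p.2.one_lt.ne]
    rw [Finset.sum_range_succ, Finset.sum_range_one, pow_zero, pow_one, ckTerm, ckTerm,
      moebius_apply_prime p.2, hp]
    simp only [moebius_apply_one, Nat.divisors_one, Finset.card_singleton]
    push_cast
    ring
  · intro e he
    have : 2 ≤ e := by simpa [Nat.succ_le_iff] using he
    rw [ckTerm, moebius_apply_prime_pow p.2 (by omega), if_neg (by omega)]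
    simp

/-- Rankin's trick for the partial sums of the divisor function. -/
lemma sum_card_divisors_le {δ : ℝ} (hδ : 0 < δ) (P : ℝ) (hP : 0 ≤ P) :
    ∑ d ∈ Finset.Icc 1 ⌊P⌋₊, (d.divisors.card : ℝ) ≤
      P ^ (1 + δ) * ∑' d : ℕ, (d.divisors.card : ℝ) / (d : ℝ) ^ (1 + δ) := by
  have hsum := summable_card_divisors_div_rpow (s := 1 + δ) (by linarith)
  rw [← tsum_mul_left]
  refine le_trans (Finset.sum_le_sum fun d hd => ?_)
    ((hsum.mul_left (P ^ (1 + δ))).sum_le_tsum (Finset.Icc 1 ⌊P⌋₊) fun d _ => by positivity)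
  have hd' := Finset.mem_Icc.1 hd
  have hd0 : (0 : ℝ) < d := by exact_mod_cast hd'.1
  have hdP : (d : ℝ) ≤ P := (Nat.le_floor_iff hP).1 hd'.2
  rw [mul_div_assoc', le_div_iff₀ (by positivity), mul_comm]
  gcongr

/-- Rankin's trick for the tail of the series defining `ck k`. -/
lemma abs_ck_sub_sum_ckTerm_le {k : ℕ} (hk : 2 ≤ k) {δ : ℝ} (hδ : 0 < δ) (hδ' : δ ≤ 1) (P : ℝ)
    (hP : 0 < P) :
    |ck k - ∑ d ∈ Finset.Icc 1 ⌊P⌋₊, ckTerm k d| ≤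
      P ^ (1 + δ) / P ^ k * ∑' d : ℕ, (d.divisors.card : ℝ) / (d : ℝ) ^ (1 + δ) := by
  have hsum := summable_card_divisors_div_rpow (s := 1 + δ) (by linarith)
  have hs := summable_abs_ckTerm hk
  have hs' : Summable (ckTerm k) := hs.of_abs
  rw [← tsum_ckTerm hk, ← hs'.sum_add_tsum_compl (s := Finset.Icc 1 ⌊P⌋₊), add_sub_cancel_left,
    ← tsum_mul_left]
  have hsub := hs.subtype (↑(Finset.Icc 1 ⌊P⌋₊) : Set ℕ)ᶜ
  have hsub' := (hsum.mul_left (P ^ (1 + δ) / P ^ k)).subtype (↑(Finset.Icc 1 ⌊P⌋₊) : Set ℕ)ᶜ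
  have h1 := norm_tsum_le_tsum_norm (f := fun d : ((↑(Finset.Icc 1 ⌊P⌋₊) : Set ℕ)ᶜ : Set ℕ) =>
    ckTerm k d) hsub
  refine h1.trans (le_trans (hsub.tsum_le_tsum (fun d => ?_) hsub') ?_)
  · obtain ⟨d, hd⟩ := d
    refine (abs_ckTerm_le k d).trans ?_
    rcases Nat.eq_zero_or_pos d with rfl | hd0
    · simp
    have hdP : P ≤ d := by
      have : ⌊P⌋₊ < d := by
        by_contra hcon
        exact hd (by simp; omega)
      exact ((Nat.floor_lt hP.le).1 this).le
    have hd1 : (0 : ℝ) < d := by exact_mod_cast hd0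
    simp only [Function.comp_apply]
    rw [div_mul_div_comm, div_le_div_iff₀ (by positivity) (by positivity)]
    have hk1 : ∀ t : ℝ, 0 < t → t ^ k = t ^ (1 + δ) * t ^ ((k : ℝ) - (1 + δ)) := fun t ht => by
      rw [← Real.rpow_add ht, ← Real.rpow_natCast]
      congr 1
      ring
    rw [hk1 P hP, hk1 d hd1]
    have h2 : P ^ ((k : ℝ) - (1 + δ)) ≤ (d : ℝ) ^ ((k : ℝ) - (1 + δ)) := by
      refine Real.rpow_le_rpow hP.le hdP ?_
      have : (2 : ℝ) ≤ k := by exact_mod_cast hk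
      linarith
    calc _ = (d.divisors.card : ℝ) * P ^ (1 + δ) * (d : ℝ) ^ (1 + δ) * P ^ ((k : ℝ) - (1 + δ)) := by
          ring
      _ ≤ (d.divisors.card : ℝ) * P ^ (1 + δ) * (d : ℝ) ^ (1 + δ) *
            (d : ℝ) ^ ((k : ℝ) - (1 + δ)) := by gcongr
      _ = _ := by ring
  · exact (hsum.mul_left (P ^ (1 + δ) / P ^ k)).tsum_subtype_le _ _ fun d => by positivity

open Finset in
/-- Summation over pairs grouped by the value of the product. -/
lemma sum_pairs_mul_le_eq (g : ℕ → ℝ) {N M : ℕ} (hNM : N ≤ M) :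
    ∑ p ∈ Icc 1 M ×ˢ Icc 1 M with p.1 * p.2 ≤ N, g (p.1 * p.2) =
      ∑ d ∈ Icc 1 N, (d.divisors.card : ℝ) * g d := by
  rw [← sum_fiberwise_of_maps_to (t := Icc 1 N) (g := fun p : ℕ × ℕ => p.1 * p.2)]
  · refine sum_congr rfl fun d hd => ?_
    have hd' := mem_Icc.1 hd
    have : {p ∈ {p ∈ Icc 1 M ×ˢ Icc 1 M | p.1 * p.2 ≤ N} | p.1 * p.2 = d} =
        d.divisorsAntidiagonal := by
      ext ⟨x, y⟩
      simp only [mem_filter, mem_product, mem_Icc, Nat.mem_divisorsAntidiagonal]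
      constructor
      · rintro ⟨-, h⟩
        exact ⟨h, by omega⟩
      · rintro ⟨h, -⟩
        have hx : 0 < x := Nat.pos_of_ne_zero (by rintro rfl; simp at h; omega)
        have hy : 0 < y := Nat.pos_of_ne_zero (by rintro rfl; simp at h; omega)
        have := Nat.le_mul_of_pos_right x hy
        have := Nat.le_mul_of_pos_left y hx
        omega
    rw [sum_congr rfl (g := fun _ => g d) fun p hp => by rw [(mem_filter.1 hp).2], this, sum_const,
      nsmul_eq_mul, ← Nat.map_div_right_divisors, card_map]
  · rintro ⟨x, y⟩ h
    simp only [mem_product, mem_Icc, mem_filter] at h ⊢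
    exact ⟨Nat.mul_pos (by omega) (by omega), h.2⟩

/-- The set of quadruples counted by `Ncount`. -/
def quadruples (k : ℕ) (X Y Z : ℝ) : Set (ℕ × ℕ × ℕ × ℕ) :=
  {q : ℕ × ℕ × ℕ × ℕ | 0 < q.1 ∧ 0 < q.2.1 ∧ 0 < q.2.2.1 ∧ 0 < q.2.2.2 ∧
    (q.1 : ℤ) * (q.2.2.1 : ℤ) ^ k - (q.2.1 : ℤ) * (q.2.2.2 : ℤ) ^ k = 1 ∧
    X < (q.2.2.1 : ℝ) ∧ (q.2.2.1 : ℝ) ≤ 2 * X ∧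
    Y < (q.2.2.2 : ℝ) ∧ (q.2.2.2 : ℝ) ≤ 2 * Y ∧
    Z < (q.2.1 : ℝ) * (q.2.2.2 : ℝ) ^ k ∧ (q.2.1 : ℝ) * (q.2.2.2 : ℝ) ^ k ≤ 2 * Z}

open Finset in
lemma quadruples_subset {k : ℕ} (hk : k ≠ 0) (X Y Z : ℝ) :
    quadruples k X Y Z ⊆ (↑(Icc 1 (⌊2 * Z⌋₊ + 1) ×ˢ Icc 1 (⌊2 * Z⌋₊ + 1) ×ˢ
      Icc 1 (⌊2 * Z⌋₊ + 1) ×ˢ Icc 1 (⌊2 * Z⌋₊ + 1)) : Set (ℕ × ℕ × ℕ × ℕ)) := by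
  rintro ⟨a, b, x, y⟩ ⟨ha, hb, hx, hy, heq, -, -, -, -, -, hZ⟩
  simp only at ha hb hx hy heq hZ
  have h1 : b * y ^ k ≤ ⌊2 * Z⌋₊ := Nat.le_floor (by exact_mod_cast hZ)
  have h2 : a * x ^ k = b * y ^ k + 1 := by
    zify
    linarith
  have hxk : 0 < x ^ k := by positivity
  have hyk : 0 < y ^ k := by positivity
  have e1 := Nat.le_mul_of_pos_right a hxk
  have e2 := Nat.le_mul_of_pos_right b hyk
  have e3 := (Nat.le_self_pow hk x).trans (Nat.le_mul_of_pos_left (x ^ k) ha)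
  have e4 := (Nat.le_self_pow hk y).trans (Nat.le_mul_of_pos_left (y ^ k) hb)
  simp only [coe_product, Set.mem_prod, coe_Icc, Set.mem_Icc]
  omega

lemma quadruples_finite {k : ℕ} (hk : k ≠ 0) (X Y Z : ℝ) : (quadruples k X Y Z).Finite :=
  (Finset.finite_toSet _).subset (quadruples_subset hk X Y Z)

lemma Ncount_le {k : ℕ} (hk : k ≠ 0) (X Y Z : ℝ) : Ncount k X Y Z ≤ (⌊2 * Z⌋₊ + 1) ^ 4 := by
  refine (Set.ncard_le_ncard (quadruples_subset hk X Y Z) (Finset.finite_toSet _)).trans ?_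
  rw [Set.ncard_coe_finset]
  simp only [Finset.card_product, Nat.card_Icc, Nat.add_sub_cancel]
  exact le_of_eq (by ring)

open Finset in
lemma sum_pairCount_le_Ncount {k : ℕ} (hk : k ≠ 0) {X Y Z : ℝ} (hZ : 0 ≤ Z)
    (A : Finset (ℕ × ℕ)) (hA : ∀ p ∈ A, 0 < p.1 ∧ 0 < p.2 ∧ X < p.1 ∧ (p.1 : ℝ) ≤ 2 * X ∧
      Y < p.2 ∧ (p.2 : ℝ) ≤ 2 * Y) :
    ∑ p ∈ A, pairCount k Z p ≤ Ncount k X Y Z := by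
  simp only [pairCount]
  rw [← card_sigma, ← Set.ncard_coe_finset]
  refine Set.ncard_le_ncard_of_injOn
    (fun s : (_ : ℕ × ℕ) × ℕ => ((s.2 + 1) / s.1.1 ^ k, s.2 / s.1.2 ^ k, s.1.1, s.1.2)) ?_ ?_
    (quadruples_finite hk X Y Z)
  · rintro ⟨⟨x, y⟩, n⟩ h
    simp only [mem_coe, mem_sigma, mem_filter, mem_Ioc] at h
    obtain ⟨hxy, ⟨hn1, hn2⟩, ⟨a, ha⟩, b, hb⟩ := h
    obtain ⟨hx, hy, h⟩ := hA _ hxy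
    simp only at hx hy h
    have hxk : 0 < x ^ k := by positivity
    have hyk : 0 < y ^ k := by positivity
    have e1 : (n + 1) / x ^ k = a := by rw [ha, Nat.mul_div_cancel_left _ hxk]
    have e2 : n / y ^ k = b := by rw [hb, Nat.mul_div_cancel_left _ hyk]
    have hnb : (b : ℝ) * (y : ℝ) ^ k = n := by
      rw [hb]
      push_cast
      ring
    refine ⟨?_, ?_, hx, hy, ?_, h.1, h.2.1, h.2.2.1, h.2.2.2, ?_, ?_⟩ <;> simp only [e1, e2]
    · exact Nat.pos_of_ne_zero (by rintro rfl; simp at ha)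
    · exact Nat.pos_of_ne_zero (by rintro rfl; simp at hb; omega)
    · zify at ha hb
      linarith
    · rw [hnb]
      exact (Nat.floor_lt hZ).1 hn1
    · rw [hnb]
      exact (Nat.le_floor_iff (by linarith)).1 hn2
  · rintro ⟨⟨x, y⟩, n⟩ h ⟨⟨x', y'⟩, n'⟩ h' heq
    simp only [mem_coe, mem_sigma, mem_filter, mem_Ioc] at h h'
    simp only [Prod.mk.injEq] at heq
    obtain ⟨-, hb, rfl, rfl⟩ := heq
    have : n = n' := by
      rw [← Nat.div_mul_cancel h.2.2.2, hb, Nat.div_mul_cancel h'.2.2.2]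
    rw [this]

lemma two_pow_clog_div_two_lt {x : ℕ} (hx : 0 < x) :
    (2 : ℝ) ^ Nat.clog 2 x / 2 < x ∧ (x : ℝ) ≤ 2 * ((2 : ℝ) ^ Nat.clog 2 x / 2) := by
  constructor
  · rcases Nat.lt_or_ge 1 x with h | h
    · have h1 := Nat.pow_pred_clog_lt_self (b := 2) (by norm_num) h
      have h2 := Nat.clog_pos (b := 2) (by norm_num) h
      obtain ⟨m, hm⟩ := Nat.exists_eq_succ_of_ne_zero h2.ne'
      rw [hm] at h1 ⊢
      have h3 : (2 : ℝ) ^ m < x := by exact_mod_cast h1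
      rw [pow_succ]
      linarith
    · obtain rfl : x = 1 := by omega
      norm_num
  · have : (x : ℝ) ≤ 2 ^ Nat.clog 2 x := by exact_mod_cast Nat.le_pow_clog (by norm_num) x
    linarith

open Finset in
/-- Dyadic decomposition of the contribution of the pairs with a large product. -/
lemma sum_pairCount_large_le {k : ℕ} (hk : k ≠ 0) (M : ℕ) {Z P S : ℝ} (hZ : 0 ≤ Z) (hP : 0 ≤ P)
    (hS0 : 0 ≤ S) (hS : ∀ X Y : ℝ, 1 / 2 ≤ X → 1 / 2 ≤ Y → P / 4 ≤ X * Y → Ncount k X Y Z ≤ S) :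
    ∑ p ∈ Icc 1 M ×ˢ Icc 1 M with ¬ p.1 * p.2 ≤ ⌊P⌋₊, (pairCount k Z p : ℝ) ≤
      ((Nat.clog 2 M : ℝ) + 1) ^ 2 * S := by
  set R := range (Nat.clog 2 M + 1)
  rw [← sum_fiberwise_of_maps_to (t := R ×ˢ R)
    (g := fun p : ℕ × ℕ => (Nat.clog 2 p.1, Nat.clog 2 p.2))]
  · have hcard : ((Nat.clog 2 M : ℝ) + 1) ^ 2 * S = ∑ _ij ∈ R ×ˢ R, S := by
      rw [sum_const, card_product, card_range, nsmul_eq_mul]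
      push_cast
      ring
    rw [hcard]
    refine sum_le_sum fun ij _ => ?_
    obtain ⟨i, j⟩ := ij
    set A := {p ∈ {p ∈ Icc 1 M ×ˢ Icc 1 M | ¬ p.1 * p.2 ≤ ⌊P⌋₊} |
      (Nat.clog 2 p.1, Nat.clog 2 p.2) = (i, j)} with hA
    have hmem : ∀ p ∈ A, 0 < p.1 ∧ 0 < p.2 ∧ (2 : ℝ) ^ i / 2 < p.1 ∧
        (p.1 : ℝ) ≤ 2 * ((2 : ℝ) ^ i / 2) ∧ (2 : ℝ) ^ j / 2 < p.2 ∧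
        (p.2 : ℝ) ≤ 2 * ((2 : ℝ) ^ j / 2) := fun p hp => by
      simp only [hA, mem_filter, mem_product, mem_Icc, Prod.mk.injEq] at hp
      obtain ⟨⟨⟨⟨h1, -⟩, h2, -⟩, -⟩, rfl, rfl⟩ := hp
      have h3 := two_pow_clog_div_two_lt h1
      have h4 := two_pow_clog_div_two_lt h2
      exact ⟨h1, h2, h3.1, h3.2, h4.1, h4.2⟩
    rcases A.eq_empty_or_nonempty with h | ⟨p, hp⟩
    · rw [h, sum_empty]
      exact hS0
    · have hpow : ∀ m : ℕ, (1 : ℝ) / 2 ≤ 2 ^ m / 2 := fun m => by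
        have : (1 : ℝ) ≤ 2 ^ m := one_le_pow₀ (by norm_num)
        linarith
      have hprod : P / 4 ≤ (2 : ℝ) ^ i / 2 * (2 ^ j / 2) := by
        obtain ⟨-, -, -, h1, -, h2⟩ := hmem p hp
        have h3 : P < ((p.1 * p.2 : ℕ) : ℝ) := by
          refine (Nat.floor_lt hP).1 ?_
          simp only [hA, mem_filter] at hp
          omega
        push_cast at h3
        have := mul_le_mul h1 h2 (by positivity) (by positivity)
        linarith
      refine le_trans ?_ (hS _ _ (hpow i) (hpow j) hprod)
      exact_mod_cast sum_pairCount_le_Ncount hk hZ A hmem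
  · rintro ⟨x, y⟩ h
    simp only [mem_product, mem_Icc, mem_filter] at h
    simp only [R, mem_product, mem_range, Nat.lt_succ_iff]
    exact ⟨Nat.clog_mono_right 2 h.1.1.2, Nat.clog_mono_right 2 h.1.2.2⟩

lemma clog_add_one_sq_le {ε Z : ℝ} (hε : 0 < ε) (hZ : 2 ≤ Z) :
    ((Nat.clog 2 (⌊2 * Z⌋₊ + 1) : ℝ) + 1) ^ 2 ≤ (6 + 4 / ε) ^ 2 * Z ^ ε := by
  set c := Nat.clog 2 (⌊2 * Z⌋₊ + 1) with hc
  have hM := Nat.floor_le (by linarith : 0 ≤ 2 * Z)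
  have h1 := (two_pow_clog_div_two_lt (x := ⌊2 * Z⌋₊ + 1) (by omega)).1
  rw [← hc] at h1
  push_cast at h1
  have h2 : (2 : ℝ) ^ c ≤ 2 * (3 * Z) := by linarith
  have h3 := Real.log_le_log (by positivity) h2
  rw [Real.log_pow, Real.log_mul (by norm_num) (by linarith), Real.log_mul (by norm_num)
    (by linarith)] at h3
  have h4 := Real.log_two_gt_d9
  have h5 := Real.log_le_sub_one_of_pos (by norm_num : (0 : ℝ) < 3)
  have h6 := Real.log_le_rpow_div (by linarith : 0 ≤ Z) (half_pos hε)
  have h7 : 1 ≤ Z ^ (ε / 2) := Real.one_le_rpow (by linarith) (by linarith)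
  have h8 : Z ^ ε = (Z ^ (ε / 2)) ^ 2 := by
    rw [← Real.rpow_natCast, ← Real.rpow_mul (by linarith)]
    congr 1
    push_cast
    ring
  have h9 : Z ^ (ε / 2) / (ε / 2) = 2 / ε * Z ^ (ε / 2) := by
    field_simp
  rw [h8, ← mul_pow]
  refine pow_le_pow_left₀ (by positivity) ?_ 2
  have h10 : ((c : ℝ) - 1) * Real.log 2 ≤ 2 + 2 / ε * Z ^ (ε / 2) := by linarith
  have h11 : 0 ≤ 2 / ε * Z ^ (ε / 2) := by positivity
  have h12 : (c : ℝ) - 1 ≤ 4 + 4 / ε * Z ^ (ε / 2) := by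
    have h13 : 4 / ε * Z ^ (ε / 2) = 2 * (2 / ε * Z ^ (ε / 2)) := by ring
    nlinarith
  linarith

open Finset ArithmeticFunction in
/-- The pairs with product at most `P` contribute the main term. -/
lemma abs_sum_pairCount_small_sub_le {k : ℕ} (M : ℕ) {Z P : ℝ} (hZ : 0 ≤ Z) (hM : ⌊P⌋₊ ≤ M) :
    |∑ p ∈ Icc 1 M ×ˢ Icc 1 M with p.1 * p.2 ≤ ⌊P⌋₊,
        (moebius (p.1 * p.2) : ℝ) * pairCount k Z p - Z * ∑ d ∈ Icc 1 ⌊P⌋₊, ckTerm k d| ≤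
      2 * ∑ d ∈ Icc 1 ⌊P⌋₊, (d.divisors.card : ℝ) := by
  have h1 : Z * ∑ d ∈ Icc 1 ⌊P⌋₊, ckTerm k d =
      ∑ p ∈ Icc 1 M ×ˢ Icc 1 M with p.1 * p.2 ≤ ⌊P⌋₊,
        (moebius (p.1 * p.2) : ℝ) * (Z / ((p.1 * p.2 : ℕ) : ℝ) ^ k) := by
    rw [sum_pairs_mul_le_eq (fun d => (moebius d : ℝ) * (Z / (d : ℝ) ^ k)) hM, mul_sum]
    refine sum_congr rfl fun d _ => ?_
    rw [ckTerm]
    ring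
  have h2 : 2 * ∑ d ∈ Icc 1 ⌊P⌋₊, (d.divisors.card : ℝ) =
      ∑ p ∈ Icc 1 M ×ˢ Icc 1 M with p.1 * p.2 ≤ ⌊P⌋₊, (2 : ℝ) := by
    rw [sum_pairs_mul_le_eq (fun _ => (2 : ℝ)) hM, mul_sum]
    exact sum_congr rfl fun d _ => mul_comm _ _
  rw [h1, h2, ← sum_sub_distrib]
  refine (abs_sum_le_sum_abs _ _).trans (sum_le_sum ?_)
  rintro ⟨x, y⟩ hp
  simp only [mem_filter, mem_product, mem_Icc] at hp
  rw [← mul_sub, abs_mul]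
  by_cases hsq : Squarefree (x * y)
  · have hle : |(moebius (x * y) : ℝ)| ≤ 1 := by exact_mod_cast abs_moebius_le_one
    have := abs_pairCount_sub_le k Z hZ x y hp.1.1.1 hp.1.2.1 (Nat.coprime_of_squarefree_mul hsq)
    calc _ ≤ (1 : ℝ) * 2 := mul_le_mul hle this (abs_nonneg _) zero_le_one
      _ = 2 := one_mul 2
  · simp [moebius_eq_zero_of_not_squarefree hsq]

theorem stmt_6 (k : ℕ) (hk : 2 ≤ k) (ε : ℝ) (hε : 0 < ε) :
    ∃ C : ℝ, 0 < C ∧ ∀ Z P : ℝ, 2 ≤ Z → Z ^ (1 / (k : ℝ)) ≤ P → P ≤ Z →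
      |AstarCount k Z - ck k * Z| ≤ C * Z ^ ε *
        (P + sSup {r : ℝ | ∃ X Y : ℝ, 1 / 2 ≤ X ∧ 1 / 2 ≤ Y ∧ P / 4 ≤ X * Y ∧
          r = (Ncount k X Y Z : ℝ)}) := by
  have hk0 : k ≠ 0 := by omega
  set δ := min ε 1 with hδdef
  have hδ : 0 < δ := lt_min hε one_pos
  have hδ1 : δ ≤ 1 := min_le_right _ _
  set W := ∑' d : ℕ, (d.divisors.card : ℝ) / (d : ℝ) ^ (1 + δ) with hW
  have hW0 : 0 ≤ W := tsum_nonneg fun d => by positivity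
  refine ⟨3 * W + (6 + 4 / ε) ^ 2, by positivity, fun Z P hZ hZP hPZ => ?_⟩
  set T := {r : ℝ | ∃ X Y : ℝ, 1 / 2 ≤ X ∧ 1 / 2 ≤ Y ∧ P / 4 ≤ X * Y ∧
    r = (Ncount k X Y Z : ℝ)} with hT
  have hZ0 : 0 < Z := by linarith
  have hP1 : 1 ≤ P := (Real.one_le_rpow (by linarith) (by positivity)).trans hZP
  have hP0 : 0 < P := by linarith
  have hbdd : BddAbove T := by
    refine ⟨(((⌊2 * Z⌋₊ + 1) ^ 4 : ℕ) : ℝ), ?_⟩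
    rintro r ⟨X, Y, -, -, -, rfl⟩
    exact_mod_cast Ncount_le hk0 X Y Z
  have hS0 : 0 ≤ sSup T := Real.sSup_nonneg (by
    rintro r ⟨X, Y, -, -, -, rfl⟩
    exact Nat.cast_nonneg _)
  have hS : ∀ X Y : ℝ, 1 / 2 ≤ X → 1 / 2 ≤ Y → P / 4 ≤ X * Y → Ncount k X Y Z ≤ sSup T :=
    fun X Y hX hY hXY => le_csSup hbdd ⟨X, Y, hX, hY, hXY, rfl⟩
  set M := ⌊2 * Z⌋₊ + 1 with hM
  have hPM : ⌊P⌋₊ ≤ M := (Nat.floor_le_floor (by linarith)).trans (Nat.le_succ _)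
  have hPδ : P ^ (1 + δ) ≤ P * Z ^ ε := by
    rw [Real.rpow_add hP0, Real.rpow_one]
    gcongr
    calc P ^ δ ≤ Z ^ δ := Real.rpow_le_rpow hP0.le hPZ hδ.le
      _ ≤ Z ^ ε := Real.rpow_le_rpow_of_exponent_le (by linarith) (min_le_left _ _)
  have hZk : Z ≤ P ^ k := by
    have h := pow_le_pow_left₀ (by positivity) hZP k
    rwa [one_div, Real.rpow_inv_natCast_pow hZ0.le hk0] at h
  have hsmall := abs_sum_pairCount_small_sub_le (k := k) M hZ0.le hPM
  have hdiv := sum_card_divisors_le hδ P hP0.le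
  have htail := abs_ck_sub_sum_ckTerm_le hk hδ hδ1 P hP0
  have hlarge := sum_pairCount_large_le hk0 M hZ0.le hP0.le hS0 hS
  have hlog := clog_add_one_sq_le hε hZ
  rw [← hM] at hlog
  rw [← hW] at hdiv htail
  rw [astarCount_eq_sum_pairCount k M Z hk0 hZ0.le le_rfl,
    ← Finset.sum_filter_add_sum_filter_not _ (fun p : ℕ × ℕ => p.1 * p.2 ≤ ⌊P⌋₊)]
  set U := ∑ p ∈ Finset.Icc 1 M ×ˢ Finset.Icc 1 M with p.1 * p.2 ≤ ⌊P⌋₊,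
    (ArithmeticFunction.moebius (p.1 * p.2) : ℝ) * pairCount k Z p
  set V := ∑ p ∈ Finset.Icc 1 M ×ˢ Finset.Icc 1 M with ¬ p.1 * p.2 ≤ ⌊P⌋₊,
    (ArithmeticFunction.moebius (p.1 * p.2) : ℝ) * pairCount k Z p with hV
  set D := ∑ d ∈ Finset.Icc 1 ⌊P⌋₊, ckTerm k d
  have hVle : |V| ≤ (6 + 4 / ε) ^ 2 * Z ^ ε * sSup T := by
    refine le_trans ?_ (hlarge.trans (mul_le_mul_of_nonneg_right hlog hS0))
    rw [hV]
    refine (Finset.abs_sum_le_sum_abs _ _).trans (Finset.sum_le_sum fun p _ => ?_)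
    have hle : |(ArithmeticFunction.moebius (p.1 * p.2) : ℝ)| ≤ 1 := by
      exact_mod_cast ArithmeticFunction.abs_moebius_le_one
    rw [abs_mul, Nat.abs_cast]
    exact mul_le_of_le_one_left (Nat.cast_nonneg _) hle
  have htail' : |Z * D - ck k * Z| ≤ W * (P * Z ^ ε) := by
    rw [mul_comm (ck k), ← mul_sub, abs_mul, abs_of_pos hZ0, abs_sub_comm]
    calc Z * |ck k - D| ≤ Z * (P ^ (1 + δ) / P ^ k * W) := by gcongr
      _ = Z / P ^ k * (W * P ^ (1 + δ)) := by ring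
      _ ≤ 1 * (W * P ^ (1 + δ)) := by
        gcongr
        exact (div_le_one (by positivity)).2 hZk
      _ ≤ W * (P * Z ^ ε) := by
        rw [one_mul]
        gcongr
  have hmain : |U - Z * D| ≤ 2 * (W * (P * Z ^ ε)) := by
    refine hsmall.trans ?_
    have : P ^ (1 + δ) * W ≤ P * Z ^ ε * W := by gcongr
    linarith
  have hsplit : U + V - ck k * Z = (U - Z * D) + (Z * D - ck k * Z) + V := by ring
  rw [hsplit]
  have h1 := abs_add_three (U - Z * D) (Z * D - ck k * Z) V
  have h2 : 0 ≤ (6 + 4 / ε) ^ 2 * (P * Z ^ ε) := by positivity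
  have h3 : 0 ≤ W * Z ^ ε * sSup T := by positivity
  linarith
end

section
/- Let k ≥ 2 be an integer, δ > 0, and c₁ ≥ 1. There exist positive integers D, κ (depending only on k, δ, c₁) such that the following holds. Let Z ≥ 2 and X, Y be reals with 1 ≤ X ≤ Y ≤ c₁·Z^{1/k} and X·Y ≥ Z^{1/k}/c₁, let M be a positive integer with M ≤ Z and log M ≥ max{ (9/2)(1+δ)·log(Z·X^{−k})·log Y / log Z , log Y }, and let s₀ be a real number with 0 ≤ s₀ ≤ 2X/Y. Then there exist integers d, e with 0 ≤ d, e ≤ D and a nonzero polynomial B ∈ ℤ[a,b,x,y] that is bihomogeneous of bidegree (d,e) (every monomial a^α b^β x^γ y^δ' of B has α+β = d and γ+δ' = e), whose coefficients all have absolute value at most Z^κ, such that B(a,b,x,y) = 0 for every quadruple of positive integers (a,b,x,y) satisfying a·x^k − b·y^k = 1, X < x ≤ 2X, Y < y ≤ 2Y, Z < b·y^k ≤ 2Z and s₀ < x/y ≤ s₀ + 1/M. -/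
/-- Real-coefficient Siegel lemma (Dirichlet's box principle). -/
theorem exists_int_vector_small_forms {ι J : Type*} [Fintype ι] [Fintype J] [DecidableEq ι]
    (A : J → ι → ℝ) (K : ℝ) (H : ℕ) (τ : J → ℝ) (hA : ∀ j i, |A j i| ≤ K)
    (hτ : ∀ j, 0 < τ j)
    (hcard : ∏ j, (2 * Fintype.card ι * K * H / τ j + 1) < ((H : ℝ) + 1) ^ Fintype.card ι) :
    ∃ c : ι → ℤ, c ≠ 0 ∧ (∀ i, |c i| ≤ H) ∧ ∀ j, |∑ i, A j i * c i| < τ j := by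
  classical
  set N := Fintype.card ι with hN
  let F : (ι → Fin (H + 1)) → J → ℤ := fun c j =>
    ⌊((∑ i, A j i * ((c i : ℕ) : ℝ)) + N * K * H) / τ j⌋
  let T : J → Finset ℤ := fun j => Finset.Icc 0 ⌊2 * N * K * H / τ j⌋
  have hb : ∀ (c : ι → Fin (H + 1)) j, |∑ i, A j i * ((c i : ℕ) : ℝ)| ≤ N * K * H := by
    intro c j
    refine (Finset.abs_sum_le_sum_abs _ _).trans ?_
    have : ∀ i ∈ Finset.univ, |A j i * ((c i : ℕ) : ℝ)| ≤ K * H := by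
      intro i _
      rw [abs_mul, Nat.abs_cast]
      have h1 : ((c i : ℕ) : ℝ) ≤ H := by exact_mod_cast Nat.lt_succ_iff.mp (c i).2
      have h2 := hA j i
      have h3 := abs_nonneg (A j i)
      gcongr
      exact h3.trans h2
    refine (Finset.sum_le_card_nsmul _ _ _ this).trans ?_
    simp [hN, mul_assoc]
  have hmaps : Set.MapsTo F (Finset.univ : Finset (ι → Fin (H + 1)))
      (Fintype.piFinset T : Finset (J → ℤ)) := by
    intro c _
    simp only [Finset.mem_coe, Fintype.mem_piFinset, T, F, Finset.mem_Icc]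
    intro j
    have := abs_le.mp (hb c j)
    refine ⟨Int.floor_nonneg.mpr (div_nonneg (by linarith) (hτ j).le), Int.floor_le_floor ?_⟩
    have := hτ j
    gcongr
    linarith
  have hlt : (Fintype.piFinset T).card < (Finset.univ : Finset (ι → Fin (H + 1))).card := by
    rw [Fintype.card_piFinset]
    have h1 : ((∏ j, (T j).card : ℕ) : ℝ) ≤ ∏ j, (2 * N * K * H / τ j + 1) := by
      push_cast
      refine Finset.prod_le_prod (fun _ _ => by positivity) fun j _ => ?_
      by_cases hi : IsEmpty ι
      · have : N = 0 := Fintype.card_eq_zero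
        simp [T, this]
      · have hi' : Nonempty ι := not_isEmpty_iff.mp hi
        obtain ⟨i⟩ := hi'
        have hK : 0 ≤ K := (abs_nonneg _).trans (hA j i)
        have hτj := hτ j
        have h0 : 0 ≤ 2 * N * K * H / τ j := by positivity
        have hf := Int.floor_nonneg.mpr h0
        have hT : ((T j).card : ℤ) = ⌊2 * N * K * H / τ j⌋ + 1 := by
          simp only [T, Int.card_Icc]
          rw [Int.toNat_of_nonneg (by omega)]
          ring
        have hT' : ((T j).card : ℝ) = (⌊2 * N * K * H / τ j⌋ : ℝ) + 1 := by exact_mod_cast hT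
        rw [hT']
        linarith [Int.floor_le (2 * N * K * H / τ j)]
    have h2 := h1.trans_lt hcard
    rw [Finset.card_univ, Fintype.card_fun, Fintype.card_fin]
    exact_mod_cast h2
  obtain ⟨c, -, c', -, hne, hF⟩ := Finset.exists_ne_map_eq_of_card_lt_of_maps_to hlt hmaps
  refine ⟨fun i => ((c i : ℕ) : ℤ) - ((c' i : ℕ) : ℤ), ?_, ?_, ?_⟩
  · intro h
    apply hne
    funext i
    have := congrFun h i
    simp only [Pi.zero_apply] at this
    ext
    omega
  · intro i
    have h1 := (c i).2
    have h2 := (c' i).2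
    change |((c i : ℕ) : ℤ) - ((c' i : ℕ) : ℤ)| ≤ H
    rw [abs_le]
    constructor <;> omega
  · intro j
    have h := Int.abs_sub_lt_one_of_floor_eq_floor (congrFun hF j)
    have hτj := hτ j
    rw [← sub_div, abs_div, abs_of_pos hτj, div_lt_one hτj] at h
    rw [add_sub_add_right_eq_sub, ← Finset.sum_sub_distrib] at h
    push_cast
    simpa only [mul_sub] using h

theorem sum_max_zero_sub_le (R m : ℝ) (hm : 0 < m) (hR : 0 ≤ R) (P Q : ℕ) :
    ∑ i ∈ Finset.range P, ∑ j ∈ Finset.range Q, max 0 (R - m * i - j) ≤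
      (R + m + 1) ^ 3 / (6 * m) := by
  have h1 : ∀ t : ℝ, max 0 t ≤ max 0 (t + 1) ^ 2 / 2 - max 0 t ^ 2 / 2 := by
    intro t
    rcases le_total 0 t with h | h
    · rw [max_eq_right h, max_eq_right (by linarith)]; nlinarith
    · rw [max_eq_left h]
      have := sq_nonneg (max 0 (t + 1))
      linarith
  have h2 : ∀ t : ℝ, max 0 t ^ 2 / 2 ≤ (max 0 (t + m) ^ 3 / 6 - max 0 t ^ 3 / 6) / m := by
    intro t
    rw [le_div_iff₀ hm]
    rcases le_total 0 t with h | h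
    · rw [max_eq_right h, max_eq_right (by linarith)]
      have : 0 ≤ t * m ^ 2 := by positivity
      have : 0 ≤ m ^ 3 := by positivity
      nlinarith
    · rw [max_eq_left h]
      have : 0 ≤ max 0 (t + m) ^ 3 := by positivity
      linarith
  have h3 : ∀ T : ℝ, ∑ j ∈ Finset.range Q, max 0 (T - j) ≤ max 0 (T + 1) ^ 2 / 2 := by
    intro T
    have : ∑ j ∈ Finset.range Q, max 0 (T - j) ≤ ∑ j ∈ Finset.range Q,
        (max 0 (T + 1 - (j : ℕ)) ^ 2 / 2 - max 0 (T + 1 - ((j + 1 : ℕ) : ℝ)) ^ 2 / 2) := by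
      refine Finset.sum_le_sum fun j _ => (h1 _).trans (le_of_eq ?_)
      rw [show T - j + 1 = T + 1 - (j : ℝ) by ring,
        show T - j = T + 1 - ((j + 1 : ℕ) : ℝ) by push_cast; ring]
    rw [Finset.sum_range_sub'] at this
    have h0 := sq_nonneg (max 0 (T + 1 - (Q : ℝ)))
    simp only [Nat.cast_zero, sub_zero] at this
    linarith
  have h4 : ∑ i ∈ Finset.range P, max 0 (R + 1 - m * i) ^ 2 / 2 ≤
      max 0 (R + 1 + m) ^ 3 / 6 / m := by
    have : ∑ i ∈ Finset.range P, max 0 (R + 1 - m * i) ^ 2 / 2 ≤ ∑ i ∈ Finset.range P,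
        (max 0 (R + 1 + m - m * (i : ℕ)) ^ 3 / 6 / m
          - max 0 (R + 1 + m - m * ((i + 1 : ℕ) : ℝ)) ^ 3 / 6 / m) := by
      refine Finset.sum_le_sum fun j _ => (h2 _).trans (le_of_eq ?_)
      rw [sub_div, show R + 1 - m * j + m = R + 1 + m - m * (j : ℝ) by ring,
        show R + 1 - m * j = R + 1 + m - m * ((j + 1 : ℕ) : ℝ) by push_cast; ring]
    rw [Finset.sum_range_sub'] at this
    have h0 : 0 ≤ max 0 (R + 1 + m - m * (P : ℝ)) ^ 3 / 6 / m := by positivity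
    simp only [Nat.cast_zero, mul_zero, sub_zero] at this
    linarith
  calc _ ≤ ∑ i ∈ Finset.range P, max 0 (R + 1 - m * i) ^ 2 / 2 := by
        refine Finset.sum_le_sum fun i _ => (h3 _).trans (le_of_eq ?_)
        rw [show R - m * i + 1 = R + 1 - m * i by ring]
    _ ≤ _ := h4
    _ = _ := by
        rw [max_eq_right (by linarith), div_div, add_right_comm]

theorem exists_bihomogeneous_of_coeffs (d e : ℕ) (c : ℕ → ℕ → ℤ) (T : ℝ)
    (hne : ∃ β ≤ d, ∃ γ ≤ e, c β γ ≠ 0)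
    (hT : ∀ β ≤ d, ∀ γ ≤ e, ((|c β γ| : ℤ) : ℝ) ≤ T) :
    ∃ B : MvPolynomial (Fin 4) ℤ, B ≠ 0 ∧
      (∀ m ∈ B.support, m 0 + m 1 = d ∧ m 2 + m 3 = e) ∧
      (∀ m ∈ B.support, ((|B.coeff m| : ℤ) : ℝ) ≤ T) ∧
      ∀ a b x y : ℤ, MvPolynomial.eval ![a, b, x, y] B =
        ∑ β ∈ Finset.range (d + 1), ∑ γ ∈ Finset.range (e + 1),
          c β γ * (a ^ (d - β) * b ^ β * x ^ γ * y ^ (e - γ)) := by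
  classical
  let f : ℕ × ℕ → (Fin 4 →₀ ℕ) := fun p =>
    Finsupp.equivFunOnFinite.symm ![d - p.1, p.1, p.2, e - p.2]
  have hf : Function.Injective f := by
    intro p q h
    have h1 := DFunLike.congr_fun h 1
    have h2 := DFunLike.congr_fun h 2
    simp [f] at h1 h2
    exact Prod.ext h1 h2
  let S := Finset.range (d + 1) ×ˢ Finset.range (e + 1)
  let B : MvPolynomial (Fin 4) ℤ := ∑ p ∈ S, MvPolynomial.monomial (f p) (c p.1 p.2)
  have hcoeff : ∀ q ∈ S, B.coeff (f q) = c q.1 q.2 := by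
    intro q hq
    simp only [B, MvPolynomial.coeff_sum, MvPolynomial.coeff_monomial, hf.eq_iff]
    rw [Finset.sum_ite_eq' S q (fun p => c p.1 p.2), if_pos hq]
  have hsupp : ∀ m ∈ B.support, ∃ q ∈ S, f q = m := by
    intro m hm
    by_contra! h
    rw [MvPolynomial.mem_support_iff] at hm
    apply hm
    simp only [B, MvPolynomial.coeff_sum, MvPolynomial.coeff_monomial]
    exact Finset.sum_eq_zero fun p hp => if_neg (h p hp)
  refine ⟨B, ?_, ?_, ?_, ?_⟩
  · obtain ⟨β, hβ, γ, hγ, h⟩ := hne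
    intro h0
    apply h
    rw [← hcoeff (β, γ) (by simp [S]; omega), h0, MvPolynomial.coeff_zero]
  · intro m hm
    obtain ⟨q, hq, rfl⟩ := hsupp m hm
    simp only [S, Finset.mem_product, Finset.mem_range] at hq
    simp [f]
    omega
  · intro m hm
    obtain ⟨q, hq, rfl⟩ := hsupp m hm
    rw [hcoeff q hq]
    simp only [S, Finset.mem_product, Finset.mem_range] at hq
    exact hT _ (by omega) _ (by omega)
  · intro a b x y
    simp only [B, map_sum, S, Finset.sum_product, MvPolynomial.eval_monomial]
    refine Finset.sum_congr rfl fun β _ => Finset.sum_congr rfl fun γ _ => ?_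
    rw [Finsupp.prod_fintype _ _ (by simp)]
    simp [f, Fin.prod_univ_four]

/-- Coefficient of `u ^ i * w ^ j` in `((s₀ + u) ^ k - 2 ^ k * w) ^ β * (s₀ + u) ^ γ`. -/
noncomputable def shiftCoeff (k : ℕ) (s₀ : ℝ) (i j β γ : ℕ) : ℝ :=
  (-2 ^ k) ^ j * (β.choose j) * ((k * (β - j) + γ).choose i * s₀ ^ (k * (β - j) + γ - i))

theorem add_pow_eq_sum_range_of_le (s u : ℝ) (n I : ℕ) (h : n < I) :
    (s + u) ^ n = ∑ i ∈ Finset.range I, n.choose i * s ^ (n - i) * u ^ i := by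
  rw [add_comm, add_pow, ← Finset.sum_subset (Finset.range_subset_range.mpr (Nat.succ_le_of_lt h))]
  · exact Finset.sum_congr rfl fun i _ => by ring
  · intro i _ hi
    rw [Nat.choose_eq_zero_of_lt (by simpa using hi)]
    simp

theorem pow_sub_pow_mul_pow_eq_sum (k : ℕ) (s₀ u w : ℝ) (β γ I J : ℕ)
    (hJ : β < J) (hI : k * β + γ < I) :
    ((s₀ + u) ^ k - 2 ^ k * w) ^ β * (s₀ + u) ^ γ =
      ∑ i ∈ Finset.range I, ∑ j ∈ Finset.range J, shiftCoeff k s₀ i j β γ * (u ^ i * w ^ j) := by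
  rw [Finset.sum_comm, sub_eq_add_neg, add_pow_eq_sum_range_of_le _ _ _ J hJ, Finset.sum_mul]
  refine Finset.sum_congr rfl fun j _ => ?_
  have h : k * (β - j) + γ < I :=
    lt_of_le_of_lt (by gcongr; omega) hI
  calc _ = (-2 ^ k) ^ j * (β.choose j) * w ^ j * (s₀ + u) ^ (k * (β - j) + γ) := by
        rw [pow_add, pow_mul, ← neg_mul, mul_pow]; ring
    _ = _ := by
        rw [add_pow_eq_sum_range_of_le _ _ _ I h, Finset.mul_sum]
        refine Finset.sum_congr rfl fun i _ => ?_
        rw [shiftCoeff]; ring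

theorem abs_shiftCoeff_le (k D : ℕ) (s₀ : ℝ) (h0 : 0 ≤ s₀) (h2 : s₀ ≤ 2) (i j β γ : ℕ)
    (hj : j ≤ D) (hβ : β ≤ D) (hγ : γ ≤ D) :
    |shiftCoeff k s₀ i j β γ| ≤ 8 ^ ((k + 1) * D) := by
  set n := k * (β - j) + γ with hn
  have hnD : n ≤ (k + 1) * D := by
    have : k * (β - j) ≤ k * D := Nat.mul_le_mul_left _ (by omega)
    rw [hn, add_mul]; omega
  have e1 : ((β.choose j : ℕ) : ℝ) ≤ 2 ^ D := by
    have : β.choose j ≤ 2 ^ D :=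
      (Nat.choose_le_two_pow β j).trans (Nat.pow_le_pow_right (by norm_num) hβ)
    exact_mod_cast this
  have e2 : ((n.choose i : ℕ) : ℝ) ≤ 2 ^ ((k + 1) * D) := by
    have : n.choose i ≤ 2 ^ ((k + 1) * D) :=
      (Nat.choose_le_two_pow n i).trans (Nat.pow_le_pow_right (by norm_num) hnD)
    exact_mod_cast this
  have e3 : s₀ ^ (n - i) ≤ 2 ^ ((k + 1) * D) :=
    (pow_le_pow_left₀ h0 h2 _).trans (pow_le_pow_right₀ (by norm_num) (by omega))
  rw [shiftCoeff, abs_mul, abs_mul, abs_pow, abs_neg, abs_pow, abs_two, ← pow_mul, Nat.abs_cast,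
    ← hn, abs_of_nonneg (a := _ * s₀ ^ (n - i)) (by positivity)]
  calc _ ≤ (2 : ℝ) ^ (k * D) * 2 ^ D * (2 ^ ((k + 1) * D) * 2 ^ ((k + 1) * D)) := by
        gcongr
        norm_num
    _ = _ := by rw [← pow_add, ← mul_pow, ← Nat.succ_mul, ← mul_pow]; norm_num

/-- The constant governing how large `Z` has to be in `exists_coeffs_small`. -/
noncomputable def boxConst (k D : ℕ) : ℝ :=
  2 * ((D : ℝ) + 1) ^ 2 * 8 ^ ((k + 1) * D) *
    (2 * 6 ^ D * (((k + 1) * D + 1 : ℕ) * (D + 1 : ℕ))) + 1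

theorem exists_coeffs_small (k D d e : ℕ) (hd : d ≤ D) (he : e ≤ D) (Z V m s₀ : ℝ)
    (hZ : 1 ≤ Z) (hV : 0 ≤ V) (hm : 0 < m) (hm1 : m ≤ 1) (h0 : 0 ≤ s₀) (h2 : s₀ ≤ 2)
    (hbig : boxConst k D ^ (((k + 1) * D + 1) * (D + 1)) * Z ^ ((3 * V + 2) ^ 3 / (6 * m)) ≤
      Z ^ (V * (((d + 1) * (e + 1) : ℕ) : ℝ))) :
    ∃ c : ℕ → ℕ → ℤ, (∃ β ≤ d, ∃ γ ≤ e, c β γ ≠ 0) ∧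
      (∀ β ≤ d, ∀ γ ≤ e, ((|c β γ| : ℤ) : ℝ) ≤ Z ^ V) ∧
      ∀ u w : ℝ, 0 ≤ u → u ≤ Z ^ (-m) → 0 ≤ w → w ≤ Z⁻¹ →
        |∑ β ∈ Finset.range (d + 1), ∑ γ ∈ Finset.range (e + 1),
          c β γ * (((s₀ + u) ^ k - 2 ^ k * w) ^ β * (s₀ + u) ^ γ)| ≤
            Z ^ (-(2 * V)) / (2 * 6 ^ D) := by
  classical
  have hZ0 : 0 < Z := by linarith
  set I := (k + 1) * D + 1 with hI
  set J := D + 1 with hJ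
  set K : ℝ := 8 ^ ((k + 1) * D) with hK
  set ε : ℝ := 1 / (2 * 6 ^ D * (I * J)) with hε
  have hIJ : (0 : ℝ) < (I : ℝ) * J := by
    have : 0 < I * J := by positivity
    exact_mod_cast this
  have hεpos : 0 < ε := by positivity
  have hC : boxConst k D = 2 * ((D : ℝ) + 1) ^ 2 * K / ε + 1 := by
    rw [boxConst, hε, ← hI, ← hJ, ← hK]
    field_simp
  have hC1 : 1 ≤ boxConst k D := by
    rw [hC]
    have : 0 ≤ 2 * ((D : ℝ) + 1) ^ 2 * K / ε := by positivity
    linarith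
  let ι := Fin (d + 1) × Fin (e + 1)
  let A : Fin I × Fin J → ι → ℝ := fun q p => shiftCoeff k s₀ q.1 q.2 p.1 p.2
  let τ : Fin I × Fin J → ℝ := fun q => ε * Z ^ (-(2 * V) + m * (q.1 : ℕ) + (q.2 : ℕ))
  set H := ⌊Z ^ V⌋₊ with hH
  have hHle : (H : ℝ) ≤ Z ^ V := Nat.floor_le (by positivity)
  have hHlt : Z ^ V < (H : ℝ) + 1 := Nat.lt_floor_add_one _
  have hcardι : Fintype.card ι = (d + 1) * (e + 1) := by simp [ι]
  have hN : (Fintype.card ι : ℝ) ≤ ((D : ℝ) + 1) ^ 2 := by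
    have : (d + 1) * (e + 1) ≤ (D + 1) ^ 2 := by rw [sq]; gcongr
    rw [hcardι]; exact_mod_cast this
  have hfac : ∀ q : Fin I × Fin J, 2 * Fintype.card ι * K * H / τ q + 1 ≤
      boxConst k D * Z ^ (max 0 (3 * V - m * (q.1 : ℕ) - (q.2 : ℕ))) := by
    intro q
    have h1 : 2 * Fintype.card ι * K * H / τ q ≤
        2 * ((D : ℝ) + 1) ^ 2 * K / ε * Z ^ (3 * V - m * (q.1 : ℕ) - (q.2 : ℕ)) := by
      calc _ ≤ 2 * ((D : ℝ) + 1) ^ 2 * K * Z ^ V / τ q := by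
            have : 0 < τ q := by positivity
            gcongr
        _ = 2 * ((D : ℝ) + 1) ^ 2 * K / ε *
            (Z ^ V / Z ^ (-(2 * V) + m * (q.1 : ℕ) + (q.2 : ℕ))) := by
            simp only [τ]; field_simp
        _ = _ := by
            rw [← Real.rpow_sub hZ0]
            congr 2; ring
    have h3 : Z ^ (3 * V - m * (q.1 : ℕ) - (q.2 : ℕ)) ≤
        Z ^ (max 0 (3 * V - m * (q.1 : ℕ) - (q.2 : ℕ))) :=
      Real.rpow_le_rpow_of_exponent_le hZ (le_max_right _ _)
    have h4 : 1 ≤ Z ^ (max 0 (3 * V - m * (q.1 : ℕ) - (q.2 : ℕ))) :=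
      Real.one_le_rpow hZ (le_max_left _ _)
    have h5 : 0 ≤ 2 * ((D : ℝ) + 1) ^ 2 * K / ε := by positivity
    rw [hC, add_mul, one_mul]
    exact add_le_add (h1.trans (mul_le_mul_of_nonneg_left h3 h5)) h4
  have hcard : ∏ q, (2 * Fintype.card ι * K * H / τ q + 1) <
      ((H : ℝ) + 1) ^ Fintype.card ι := by
    calc _ ≤ ∏ q : Fin I × Fin J,
          boxConst k D * Z ^ (max 0 (3 * V - m * (q.1 : ℕ) - (q.2 : ℕ))) := by
          refine Finset.prod_le_prod (fun q _ => ?_) fun q _ => hfac q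
          have : 0 < τ q := by positivity
          positivity
      _ = boxConst k D ^ (I * J) * Z ^ (∑ i ∈ Finset.range I, ∑ j ∈ Finset.range J,
            max 0 (3 * V - m * i - j)) := by
          rw [Finset.prod_mul_distrib, Finset.prod_const, Finset.card_univ, Fintype.card_prod,
            Fintype.card_fin, Fintype.card_fin, ← Real.rpow_sum_of_pos hZ0,
            Fintype.sum_prod_type, ← Fin.sum_univ_eq_sum_range
              (fun i => ∑ j ∈ Finset.range J, max 0 (3 * V - m * i - j)) I]
          congr 2
          refine Finset.sum_congr rfl fun i _ => ?_
          rw [← Fin.sum_univ_eq_sum_range (fun j => max 0 (3 * V - m * (i : ℕ) - (j : ℝ))) J]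
      _ ≤ boxConst k D ^ (I * J) * Z ^ ((3 * V + 2) ^ 3 / (6 * m)) := by
          refine mul_le_mul_of_nonneg_left (Real.rpow_le_rpow_of_exponent_le hZ ?_) (by positivity)
          refine (sum_max_zero_sub_le (3 * V) m hm (by positivity) I J).trans ?_
          gcongr ?_ ^ 3 / _
          linarith
      _ ≤ Z ^ (V * (((d + 1) * (e + 1) : ℕ) : ℝ)) := hbig
      _ = (Z ^ V) ^ Fintype.card ι := by
          rw [Real.rpow_mul hZ0.le, Real.rpow_natCast, hcardι]
      _ < _ := by
          have : Fintype.card ι ≠ 0 := by rw [hcardι]; positivity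
          gcongr
  obtain ⟨c, hc0, hcH, hcτ⟩ := exists_int_vector_small_forms A K H τ
    (fun q p => abs_shiftCoeff_le k D s₀ h0 h2 _ _ _ _ (by omega) (by omega) (by omega))
    (fun q => by positivity) hcard
  let c' : ℕ → ℕ → ℤ := fun β γ =>
    if h : β < d + 1 ∧ γ < e + 1 then c (⟨β, h.1⟩, ⟨γ, h.2⟩) else 0
  have hc' : ∀ p : ι, c' p.1 p.2 = c p := fun p => by
    simp only [c']; rw [dif_pos ⟨p.1.2, p.2.2⟩]
  refine ⟨c', ?_, ?_, ?_⟩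
  · obtain ⟨p, hp⟩ := Function.ne_iff.mp hc0
    exact ⟨p.1, by omega, p.2, by omega, by rw [hc']; exact hp⟩
  · intro β hβ γ hγ
    have := hcH (⟨β, by omega⟩, ⟨γ, by omega⟩)
    rw [← hc'] at this
    refine le_trans ?_ hHle
    exact_mod_cast this
  · intro u w hu hum hw hwZ
    have hexp : ∑ β ∈ Finset.range (d + 1), ∑ γ ∈ Finset.range (e + 1),
          c' β γ * (((s₀ + u) ^ k - 2 ^ k * w) ^ β * (s₀ + u) ^ γ) =
        ∑ q : Fin I × Fin J, (∑ p, A q p * c p) * (u ^ (q.1 : ℕ) * w ^ (q.2 : ℕ)) := by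
      rw [← Fin.sum_univ_eq_sum_range (fun β => ∑ γ ∈ Finset.range (e + 1),
          c' β γ * (((s₀ + u) ^ k - 2 ^ k * w) ^ β * (s₀ + u) ^ γ)) (d + 1)]
      have hswap : ∑ q : Fin I × Fin J, (∑ p, A q p * c p) * (u ^ (q.1 : ℕ) * w ^ (q.2 : ℕ)) =
          ∑ p : ι, ∑ q : Fin I × Fin J, A q p * c p * (u ^ (q.1 : ℕ) * w ^ (q.2 : ℕ)) := by
        simp_rw [Finset.sum_mul]
        exact Finset.sum_comm
      rw [hswap, Fintype.sum_prod_type]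
      refine Finset.sum_congr rfl fun β _ => ?_
      rw [← Fin.sum_univ_eq_sum_range (fun γ =>
          c' β γ * (((s₀ + u) ^ k - 2 ^ k * w) ^ (β : ℕ) * (s₀ + u) ^ γ)) (e + 1)]
      refine Finset.sum_congr rfl fun γ _ => ?_
      have hβI : k * (β : ℕ) + γ < I := by
        have : k * (β : ℕ) ≤ k * D := Nat.mul_le_mul_left _ (by omega)
        rw [hI, add_mul]; omega
      rw [hc' (β, γ), pow_sub_pow_mul_pow_eq_sum k s₀ u w β γ I J (by omega) hβI,
        Fintype.sum_prod_type, Finset.mul_sum,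
        ← Fin.sum_univ_eq_sum_range (fun i => (c (β, γ) : ℝ) *
          ∑ j ∈ Finset.range J, shiftCoeff k s₀ i j β γ * (u ^ i * w ^ j)) I]
      refine Finset.sum_congr rfl fun i _ => ?_
      rw [Finset.mul_sum, ← Fin.sum_univ_eq_sum_range (fun j => (c (β, γ) : ℝ) *
          (shiftCoeff k s₀ i j β γ * (u ^ (i : ℕ) * w ^ j))) J]
      exact Finset.sum_congr rfl fun j _ => by simp only [A]; ring
    rw [hexp]
    refine (Finset.abs_sum_le_sum_abs _ _).trans ?_
    have hterm : ∀ q ∈ (Finset.univ : Finset (Fin I × Fin J)),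
        |(∑ p, A q p * c p) * (u ^ (q.1 : ℕ) * w ^ (q.2 : ℕ))| ≤ ε * Z ^ (-(2 * V)) := by
      intro q _
      rw [abs_mul, abs_of_nonneg (a := u ^ (q.1 : ℕ) * w ^ (q.2 : ℕ)) (by positivity)]
      calc _ ≤ τ q * ((Z ^ (-m)) ^ (q.1 : ℕ) * (Z⁻¹) ^ (q.2 : ℕ)) := by
            have := (hcτ q).le
            gcongr
        _ = ε * Z ^ (-(2 * V)) := by
            simp only [τ]
            rw [← Real.rpow_natCast (Z ^ (-m)), ← Real.rpow_mul hZ0.le, ← Real.rpow_neg_one,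
              ← Real.rpow_natCast (Z ^ (-1 : ℝ)), ← Real.rpow_mul hZ0.le, ← Real.rpow_add hZ0,
              mul_assoc, ← Real.rpow_add hZ0]
            congr 2; ring
    refine (Finset.sum_le_card_nsmul _ _ _ hterm).trans (le_of_eq ?_)
    simp only [Finset.card_univ, Fintype.card_prod, Fintype.card_fin, nsmul_eq_mul, Nat.cast_mul,
      hε]
    field_simp
    exact div_self hIJ.ne'

theorem sum_bihomogeneous_eq (d e : ℕ) (c : ℕ → ℕ → ℤ) (a b x y : ℝ) (ha : a ≠ 0) (hy : y ≠ 0) :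
    ∑ β ∈ Finset.range (d + 1), ∑ γ ∈ Finset.range (e + 1),
        c β γ * (a ^ (d - β) * b ^ β * x ^ γ * y ^ (e - γ)) =
      a ^ d * y ^ e * ∑ β ∈ Finset.range (d + 1), ∑ γ ∈ Finset.range (e + 1),
        c β γ * ((b / a) ^ β * (x / y) ^ γ) := by
  simp_rw [Finset.mul_sum]
  refine Finset.sum_congr rfl fun β hβ => Finset.sum_congr rfl fun γ hγ => ?_
  rw [Finset.mem_range] at hβ hγ
  have h1 : a ^ d = a ^ (d - β) * a ^ β := by rw [← pow_add, Nat.sub_add_cancel (by omega)]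
  have h2 : y ^ e = y ^ (e - γ) * y ^ γ := by rw [← pow_add, Nat.sub_add_cancel (by omega)]
  rw [h1, h2, div_pow, div_pow]
  field_simp

/-- A fixed binary form vanishing at all pairs of positive integers up to `n`. -/
theorem exists_form_vanishing_on_box (n : ℕ) :
    ∃ (e : ℕ) (c : ℕ → ℤ), (∃ γ ≤ e, c γ ≠ 0) ∧
      ∀ x y : ℕ, 0 < y → x ≤ n → y ≤ n →
        ∑ γ ∈ Finset.range (e + 1), (c γ : ℝ) * ((x : ℝ) / y) ^ γ = 0 := by
  let F : Polynomial ℤ := ∏ p ∈ Finset.range (n + 1) ×ˢ Finset.range (n + 1),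
    if p.2 = 0 then 1 else (Polynomial.C (p.2 : ℤ) * Polynomial.X - Polynomial.C (p.1 : ℤ))
  have hF : F ≠ 0 := by
    refine Finset.prod_ne_zero_iff.mpr fun p _ => ?_
    split_ifs with h
    · exact one_ne_zero
    · intro h0
      have := congrArg (fun f => Polynomial.coeff f 1) h0
      simp at this
      exact h this
  refine ⟨F.natDegree, F.coeff, ⟨F.natDegree, le_rfl, by simpa using hF⟩, ?_⟩
  intro x y hy hx hyn
  have h1 : Polynomial.aeval ((x : ℝ) / y) F = 0 := by
    simp only [F, map_prod]
    refine Finset.prod_eq_zero (i := (x, y)) (by simp; omega) ?_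
    have : (y : ℝ) ≠ 0 := by positivity
    rw [if_neg (by simpa using hy.ne')]
    simp
    field_simp
    simp
  rw [Polynomial.aeval_eq_sum_range] at h1
  simpa using h1

theorem exponent_inequality {δ V α υ m d e : ℝ} (hδ : 0 < δ) (hV : 0 < V)
    (hVδ : (V + 2 / 3) ^ 3 ≤ (1 + δ / 2) * V ^ 3) (hα : 0 < α) (hυ : 0 < υ)
    (hαυ : α * υ ≤ 2) (hm : 9 / 2 * (1 + δ) * (α * υ) ≤ m)
    (hd : V / α ≤ d) (he : V / υ ≤ e) :
    V ^ 3 * (δ / 2) / (1 + δ) / 2 + (3 * V + 2) ^ 3 / (6 * m) ≤ V * (d * e) := by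
  set t := α * υ with ht
  have ht0 : 0 < t := by positivity
  have hm0 : 0 < m := lt_of_lt_of_le (by positivity) hm
  have h1 : V ^ 3 * (δ / 2) / (1 + δ) / 2 ≤ V ^ 3 * (δ / 2) / (1 + δ) / t := by gcongr
  have h2 : (3 * V + 2) ^ 3 / (6 * m) ≤ (1 + δ / 2) * V ^ 3 / (1 + δ) / t := by
    calc (3 * V + 2) ^ 3 / (6 * m) = 27 * (V + 2 / 3) ^ 3 / (6 * m) := by ring
      _ ≤ 27 * ((1 + δ / 2) * V ^ 3) / (6 * (9 / 2 * (1 + δ) * t)) := by gcongr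
      _ = _ := by field_simp; norm_num
  have h3 : V ^ 3 * (δ / 2) / (1 + δ) / t + (1 + δ / 2) * V ^ 3 / (1 + δ) / t =
      V * (V / α * (V / υ)) := by
    rw [ht]; field_simp; ring
  have h4 : V * (V / α * (V / υ)) ≤ V * (d * e) := by
    have : 0 < V / α := by positivity
    have : 0 < V / υ := by positivity
    gcongr
    linarith
  linarith

theorem exists_pos_shift_cube_le (δ : ℝ) (hδ : 0 < δ) :
    ∃ V : ℝ, 0 < V ∧ (V + 2 / 3) ^ 3 ≤ (1 + δ / 2) * V ^ 3 := by
  refine ⟨14 / δ + 1, by positivity, ?_⟩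
  set V := 14 / δ + 1 with hV
  have h14 : 0 < 14 / δ := by positivity
  have h1 : 14 ≤ δ * V := by
    rw [hV, mul_add, mul_div_cancel₀ _ hδ.ne']; linarith
  have hV1 : 1 ≤ V := by linarith
  have h2 : 14 * V ^ 2 ≤ δ * V * V ^ 2 := by gcongr
  nlinarith [mul_nonneg (sub_nonneg.mpr hV1) (sub_nonneg.mpr hV1)]

/-- If `s = x / y` and `a x ^ k - b y ^ k = 1`, then `b / a` is within `2 ^ k / Z` of `s ^ k`,
from below. -/
theorem div_eq_pow_sub_of_sub_eq_one {k : ℕ} {Z a b x y : ℝ} (hZ : 0 < Z) (ha : 0 < a)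
    (hx : 0 < x) (hy : 0 < y) (h : a * x ^ k - b * y ^ k = 1) (hxy : x ≤ 2 * y)
    (hb : Z < b * y ^ k) :
    ∃ w : ℝ, 0 ≤ w ∧ w ≤ Z⁻¹ ∧ b / a = (x / y) ^ k - 2 ^ k * w := by
  refine ⟨1 / (2 ^ k * (a * y ^ k)), by positivity, ?_, ?_⟩
  · rw [← one_div]
    gcongr
    have h1 : a * x ^ k ≤ a * (2 * y) ^ k := by gcongr
    rw [mul_pow] at h1
    linarith
  · rw [div_pow]
    field_simp
    linarith

theorem sum_bihomogeneous_eq_zero {k D d e : ℕ} (hd : d ≤ D) (he : e ≤ D) {Z V m s₀ X Y α υ : ℝ}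
    (c : ℕ → ℕ → ℤ) (hZ : 1 ≤ Z) (hX : 1 ≤ X) (hXY : X ≤ Y)
    (hc : ∀ u w : ℝ, 0 ≤ u → u ≤ Z ^ (-m) → 0 ≤ w → w ≤ Z⁻¹ →
        |∑ β ∈ Finset.range (d + 1), ∑ γ ∈ Finset.range (e + 1),
          c β γ * (((s₀ + u) ^ k - 2 ^ k * w) ^ β * (s₀ + u) ^ γ)| ≤
            Z ^ (-(2 * V)) / (2 * 6 ^ D))
    (hα : Z / X ^ k ≤ Z ^ α) (hυ : Y = Z ^ υ) (hdα : α * d ≤ V) (heυ : υ * e ≤ V)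
    {a b x y : ℕ} (ha : 0 < a) (hx : 0 < x) (hy : 0 < y)
    (h : (a : ℤ) * (x : ℤ) ^ k - (b : ℤ) * (y : ℤ) ^ k = 1)
    (hXx : X < (x : ℝ)) (hxX : (x : ℝ) ≤ 2 * X) (hYy : Y < (y : ℝ)) (hyY : (y : ℝ) ≤ 2 * Y)
    (hZb : Z < (b : ℝ) * (y : ℝ) ^ k) (hbZ : (b : ℝ) * (y : ℝ) ^ k ≤ 2 * Z)
    (hs : s₀ < (x : ℝ) / (y : ℝ)) (hsM : (x : ℝ) / (y : ℝ) ≤ s₀ + Z ^ (-m)) :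
    ∑ β ∈ Finset.range (d + 1), ∑ γ ∈ Finset.range (e + 1),
      c β γ * ((a : ℤ) ^ (d - β) * (b : ℤ) ^ β * (x : ℤ) ^ γ * (y : ℤ) ^ (e - γ)) = 0 := by
  have hZ0 : 0 < Z := by linarith
  have ha' : (0 : ℝ) < a := by exact_mod_cast ha
  have hx' : (0 : ℝ) < x := by exact_mod_cast hx
  have hy' : (0 : ℝ) < y := by exact_mod_cast hy
  have hR : (a : ℝ) * (x : ℝ) ^ k - (b : ℝ) * (y : ℝ) ^ k = 1 := by exact_mod_cast h
  obtain ⟨w, hw0, hwZ, hw⟩ := div_eq_pow_sub_of_sub_eq_one hZ0 ha' hx' hy' hR (by linarith) hZb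
  have hsmall := hc ((x : ℝ) / y - s₀) w (by linarith) (by linarith) hw0 hwZ
  rw [add_sub_cancel, ← hw] at hsmall
  have hX0 : 0 < X := by linarith
  have haZ : (a : ℝ) ≤ 3 * Z ^ α := by
    have h1 : (a : ℝ) * X ^ k ≤ 3 * Z := by
      have : (a : ℝ) * X ^ k ≤ a * (x : ℝ) ^ k := by gcongr
      linarith
    have h2 : (a : ℝ) ≤ 3 * Z / X ^ k := by rwa [le_div_iff₀ (by positivity)]
    rw [mul_div_assoc] at h2
    linarith
  have hyZ : (y : ℝ) ≤ 2 * Z ^ υ := by rw [← hυ]; exact hyY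
  have hsize : (a : ℝ) ^ d * (y : ℝ) ^ e ≤ 6 ^ D * Z ^ (2 * V) := by
    calc (a : ℝ) ^ d * (y : ℝ) ^ e ≤ (3 * Z ^ α) ^ d * (2 * Z ^ υ) ^ e := by gcongr
      _ = 3 ^ d * 2 ^ e * Z ^ (α * d + υ * e) := by
          rw [Real.rpow_add hZ0, Real.rpow_mul hZ0.le, Real.rpow_mul hZ0.le, Real.rpow_natCast,
            Real.rpow_natCast]
          ring
      _ ≤ 3 ^ D * 2 ^ D * Z ^ (2 * V) := by
          gcongr
          · norm_num
          · norm_num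
          · linarith
      _ = _ := by rw [← mul_pow]; norm_num
  rw [← Int.abs_lt_one_iff]
  have hlt : |((∑ β ∈ Finset.range (d + 1), ∑ γ ∈ Finset.range (e + 1),
      c β γ * ((a : ℤ) ^ (d - β) * (b : ℤ) ^ β * (x : ℤ) ^ γ * (y : ℤ) ^ (e - γ)) : ℤ) : ℝ)| <
        1 := by
    push_cast
    rw [sum_bihomogeneous_eq d e c _ _ _ _ ha'.ne' hy'.ne', abs_mul, abs_of_nonneg (by positivity)]
    calc _ ≤ 6 ^ D * Z ^ (2 * V) * (Z ^ (-(2 * V)) / (2 * 6 ^ D)) := by gcongr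
      _ = 1 / 2 := by
          rw [Real.rpow_neg hZ0.le]
          field_simp
      _ < 1 := by norm_num
  exact_mod_cast hlt

/-- The sizes of `X`, `Y` and `M` on the logarithmic scale of `Z`; the exponent `α` of `Z / X ^ k`
is rounded up so as to stay away from `0`. -/
theorem exists_log_scale_exponents {k : ℕ} (hk : 2 ≤ k) {δ c₁ : ℝ} (hδ : 0 < δ) (hc₁ : 1 ≤ c₁)
    {Z X Y : ℝ} {M : ℕ} (hcZ : c₁ ^ (2 * k) ≤ Z) (hZ1 : 1 < Z) (hX : 1 ≤ X) (hXY : X ≤ Y)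
    (hYZ : Y ≤ c₁ * Z ^ (1 / (k : ℝ))) (hZXY : Z ^ (1 / (k : ℝ)) / c₁ ≤ X * Y)
    (hM : 0 < M) (hMZ : (M : ℝ) ≤ Z)
    (hlog : max ((9 / 2) * (1 + δ) * Real.log (Z / X ^ k) * Real.log Y / Real.log Z)
      (Real.log Y) ≤ Real.log M) :
    ∃ α υ m : ℝ, 2 / 9 / (1 + δ) ≤ α ∧ α ≤ 1 ∧ 1 / (4 * (k : ℝ)) ≤ υ ∧ υ ≤ 2 ∧ υ ≤ m ∧ m ≤ 1 ∧
      9 / 2 * (1 + δ) * (α * υ) ≤ m ∧ Z / X ^ k ≤ Z ^ α ∧ Y = Z ^ υ ∧ 1 / (M : ℝ) = Z ^ (-m) := by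
  have hk0 : (0 : ℝ) < k := by positivity
  have hZ0 : 0 < Z := by linarith
  have hX0 : 0 < X := by linarith
  have hY0 : 0 < Y := by linarith
  have hM0 : (0 : ℝ) < M := by exact_mod_cast hM
  have hL : 0 < Real.log Z := Real.log_pos hZ1
  set L := Real.log Z with hLdef
  have hlc : 2 * k * Real.log c₁ ≤ L := by
    have h2 := Real.log_le_log (by positivity) hcZ
    rw [Real.log_pow] at h2
    push_cast at h2
    exact h2
  have hlc0 : 0 ≤ Real.log c₁ := Real.log_nonneg hc₁
  have hlY1 : 1 / (k : ℝ) * L - Real.log c₁ ≤ 2 * Real.log Y := by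
    have h1 : Z ^ (1 / (k : ℝ)) / c₁ ≤ Y ^ 2 := hZXY.trans (by nlinarith)
    have h2 := Real.log_le_log (by positivity) h1
    rw [Real.log_div (by positivity) (by positivity), Real.log_rpow hZ0, Real.log_pow] at h2
    exact_mod_cast h2
  have hlY2 : Real.log Y ≤ Real.log c₁ + 1 / (k : ℝ) * L := by
    have h2 := Real.log_le_log hY0 hYZ
    rwa [Real.log_mul (by positivity) (by positivity), Real.log_rpow hZ0] at h2
  set υ := Real.log Y / L with hυ
  set m := Real.log M / L with hm
  set α₀ := Real.log (Z / X ^ k) / L with hα₀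
  set α := max α₀ (2 / 9 / (1 + δ)) with hα
  have hυ1 : 1 / (4 * k) ≤ υ := by
    rw [hυ, le_div_iff₀ hL]
    have : Real.log c₁ ≤ L / (2 * k) := by
      rw [le_div_iff₀ (by positivity)]; linarith
    have e1 : L / (2 * k) = 2 * (1 / (4 * k) * L) := by field_simp; norm_num
    have e2 : 1 / (k : ℝ) * L = 4 * (1 / (4 * k) * L) := by field_simp
    linarith
  have hυ0 : 0 < υ := lt_of_lt_of_le (by positivity) hυ1
  have hk2 : (2 : ℝ) ≤ k := by exact_mod_cast hk
  have hυ2 : υ ≤ 2 := by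
    rw [hυ, div_le_iff₀ hL]
    have h1 : 1 / (k : ℝ) * L ≤ 1 * L := by
      gcongr
      rw [div_le_one hk0]; linarith
    have h3 : 2 * 2 * Real.log c₁ ≤ 2 * k * Real.log c₁ := by gcongr
    linarith
  have hα0 : 0 < α := lt_of_lt_of_le (by positivity) (le_max_right _ _)
  have hα1 : α ≤ 1 := by
    refine max_le ?_ ?_
    · rw [hα₀, div_le_one hL]
      refine Real.log_le_log (by positivity) (div_le_self hZ0.le (one_le_pow₀ hX))
    · rw [div_le_one (by positivity)]; linarith
  have hmυ : υ ≤ m := by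
    rw [hυ, hm]
    exact div_le_div_of_nonneg_right (le_of_max_le_right hlog) hL.le
  have hm1 : m ≤ 1 := by
    rw [hm, div_le_one hL]
    exact Real.log_le_log hM0 hMZ
  have hmα : 9 / 2 * (1 + δ) * (α * υ) ≤ m := by
    have h1 : 9 / 2 * (1 + δ) * (α₀ * υ) ≤ m := by
      have := le_of_max_le_left hlog
      rw [hm, le_div_iff₀ hL]
      refine le_trans (le_of_eq ?_) this
      rw [hα₀, hυ]; field_simp
    have h2 : 9 / 2 * (1 + δ) * (2 / 9 / (1 + δ) * υ) ≤ m := by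
      refine le_trans (le_of_eq ?_) hmυ
      field_simp
    rcases max_choice α₀ (2 / 9 / (1 + δ)) with h | h <;> rw [hα, h] <;> assumption
  have hexpL : ∀ t : ℝ, Z ^ (t / L) = Real.exp t := fun t => by
    rw [Real.rpow_def_of_pos hZ0, ← hLdef, mul_div_cancel₀ _ hL.ne']
  have hYυ : Y = Z ^ υ := by rw [hυ, hexpL, Real.exp_log hY0]
  have hXα : Z / X ^ k ≤ Z ^ α := by
    calc Z / X ^ k = Z ^ α₀ := by rw [hα₀, hexpL, Real.exp_log (by positivity)]
      _ ≤ Z ^ α := Real.rpow_le_rpow_of_exponent_le hZ1.le (le_max_left _ _)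
  have hMm : 1 / (M : ℝ) = Z ^ (-m) := by
    rw [Real.rpow_neg hZ0.le, hm, hexpL, Real.exp_log hM0, one_div]
  exact ⟨α, υ, m, le_max_right _ _, hα1, hυ1, hυ2, hmυ, hm1, hmα, hXα, hYυ, hMm⟩

theorem exists_bihomogeneous_of_large (k : ℕ) (hk : 2 ≤ k) (δ c₁ : ℝ) (hδ : 0 < δ)
    (hc₁ : 1 ≤ c₁) :
    ∃ (D : ℕ) (V Z₀ : ℝ),
      ∀ (Z X Y : ℝ) (M : ℕ) (s₀ : ℝ), Z₀ ≤ Z →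
        2 ≤ Z → 1 ≤ X → X ≤ Y → Y ≤ c₁ * Z ^ (1 / (k : ℝ)) →
        Z ^ (1 / (k : ℝ)) / c₁ ≤ X * Y →
        0 < M → (M : ℝ) ≤ Z →
        max ((9 / 2) * (1 + δ) * Real.log (Z / X ^ k) * Real.log Y / Real.log Z)
          (Real.log Y) ≤ Real.log M →
        0 ≤ s₀ → s₀ ≤ 2 * X / Y →
        ∃ (d e : ℕ) (B : MvPolynomial (Fin 4) ℤ),
          d ≤ D ∧ e ≤ D ∧ B ≠ 0 ∧
          (∀ m ∈ B.support, m 0 + m 1 = d ∧ m 2 + m 3 = e) ∧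
          (∀ m ∈ B.support, ((|B.coeff m| : ℤ) : ℝ) ≤ Z ^ V) ∧
          ∀ a b x y : ℕ, 0 < a → 0 < b → 0 < x → 0 < y →
            (a : ℤ) * (x : ℤ) ^ k - (b : ℤ) * (y : ℤ) ^ k = 1 →
            X < (x : ℝ) → (x : ℝ) ≤ 2 * X → Y < (y : ℝ) → (y : ℝ) ≤ 2 * Y →
            Z < (b : ℝ) * (y : ℝ) ^ k → (b : ℝ) * (y : ℝ) ^ k ≤ 2 * Z →
            s₀ < (x : ℝ) / (y : ℝ) → (x : ℝ) / (y : ℝ) ≤ s₀ + 1 / (M : ℝ) →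
            MvPolynomial.eval ![(a : ℤ), (b : ℤ), (x : ℤ), (y : ℤ)] B = 0 := by
  obtain ⟨V, hV, hVδ⟩ := exists_pos_shift_cube_le δ hδ
  set D := ⌈V * (9 / 2 * (1 + δ)) + V * (4 * k)⌉₊ with hD
  set P := ((k + 1) * D + 1) * (D + 1) with hP
  set η := V ^ 3 * (δ / 2) / (1 + δ) / 2 with hη
  have hη0 : 0 < η := by positivity
  have hbox : 0 < boxConst k D := by unfold boxConst; positivity
  refine ⟨D, V, c₁ ^ (2 * k) + (boxConst k D ^ P) ^ (1 / η), ?_⟩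
  intro Z X Y M s₀ hZ₀ hZ2 hX hXY hYZ hZXY hM hMZ hlog hs0 hs2
  have hZ0 : 0 < Z := by linarith
  have hZ1 : 1 < Z := by linarith
  have hY0 : 0 < Y := by linarith
  have hp1 : 0 < (boxConst k D ^ P) ^ (1 / η) := by positivity
  have hp2 : 0 < c₁ ^ (2 * k) := by positivity
  have hZbox : boxConst k D ^ P ≤ Z ^ η := by
    have h1 : (boxConst k D ^ P) ^ (1 / η) ≤ Z := by linarith
    calc boxConst k D ^ P = ((boxConst k D ^ P) ^ (1 / η)) ^ η := by
          rw [← Real.rpow_mul (by positivity), one_div_mul_cancel hη0.ne', Real.rpow_one]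
      _ ≤ Z ^ η := by gcongr
  obtain ⟨α, υ, m, hα2, hα1, hυ1, hυ2, hmυ, hm1, hmα, hXα, hYυ, hMm⟩ :=
    exists_log_scale_exponents hk hδ hc₁ (by linarith) hZ1 hX hXY hYZ hZXY hM hMZ hlog
  have hυ0 : 0 < υ := lt_of_lt_of_le (by positivity) hυ1
  have hα0 : 0 < α := lt_of_lt_of_le (by positivity) hα2
  have hαυ : α * υ ≤ 2 := (mul_le_of_le_one_left hυ0.le hα1).trans hυ2
  set d := ⌊V / α⌋₊ with hd
  set e := ⌊V / υ⌋₊ with he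
  have hdle : (d : ℝ) ≤ V / α := Nat.floor_le (by positivity)
  have hele : (e : ℝ) ≤ V / υ := Nat.floor_le (by positivity)
  have hdD : d ≤ D := by
    have h1 : V / α ≤ V * (9 / 2 * (1 + δ)) := by
      rw [div_le_iff₀ hα0, mul_assoc]
      have h2 : 1 ≤ 9 / 2 * (1 + δ) * α := by
        calc (1 : ℝ) = 9 / 2 * (1 + δ) * (2 / 9 / (1 + δ)) := by field_simp
          _ ≤ _ := by gcongr
      exact le_mul_of_one_le_right hV.le h2
    have h3 : 0 ≤ V * (4 * k) := by positivity
    have h4 := Nat.le_ceil (V * (9 / 2 * (1 + δ)) + V * (4 * k))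
    have : (d : ℝ) ≤ D := by linarith
    exact_mod_cast this
  have heD : e ≤ D := by
    have h1 : V / υ ≤ V * (4 * k) := by
      rw [div_le_iff₀ hυ0, mul_assoc]
      have h2 : 1 ≤ 4 * k * υ := by
        rw [div_le_iff₀ (by positivity)] at hυ1
        linarith
      exact le_mul_of_one_le_right hV.le h2
    have h3 : 0 ≤ V * (9 / 2 * (1 + δ)) := by positivity
    have h4 := Nat.le_ceil (V * (9 / 2 * (1 + δ)) + V * (4 * k))
    have : (e : ℝ) ≤ D := by linarith
    exact_mod_cast this
  have hs2' : s₀ ≤ 2 := hs2.trans (by rw [div_le_iff₀ hY0]; linarith)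
  have hbig : boxConst k D ^ P * Z ^ ((3 * V + 2) ^ 3 / (6 * m)) ≤
      Z ^ (V * (((d + 1) * (e + 1) : ℕ) : ℝ)) := by
    calc _ ≤ Z ^ η * Z ^ ((3 * V + 2) ^ 3 / (6 * m)) := by gcongr
      _ = Z ^ (η + (3 * V + 2) ^ 3 / (6 * m)) := (Real.rpow_add hZ0 _ _).symm
      _ ≤ _ := by
          refine Real.rpow_le_rpow_of_exponent_le hZ1.le ?_
          push_cast
          exact exponent_inequality hδ hV hVδ hα0 hυ0 hαυ hmα
            (Nat.lt_floor_add_one _).le (Nat.lt_floor_add_one _).le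
  obtain ⟨c, hne, hcV, hc⟩ := exists_coeffs_small k D d e hdD heD Z V m s₀ hZ1.le hV.le
    (hυ0.trans_le hmυ) hm1 hs0 hs2' hbig
  obtain ⟨B, hB0, hBs, hBc, hBe⟩ := exists_bihomogeneous_of_coeffs d e c _ hne hcV
  refine ⟨d, e, B, hdD, heD, hB0, hBs, hBc, ?_⟩
  intro a b x y ha _ hx hy h h1 h2 h3 h4 h5 h6 h7 h8
  rw [hBe]
  rw [hMm] at h8
  refine sum_bihomogeneous_eq_zero hdD heD c hZ1.le hX hXY hc hXα hYυ ?_ ?_ ha hx hy h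
    h1 h2 h3 h4 h5 h6 h7 h8
  · rw [mul_comm]; exact (le_div_iff₀ hα0).mp hdle
  · rw [mul_comm]; exact (le_div_iff₀ hυ0).mp hele

theorem stmt_7 (k : ℕ) (hk : 2 ≤ k) (δ c₁ : ℝ) (hδ : 0 < δ) (hc₁ : 1 ≤ c₁) :
    ∃ D κ : ℕ, 0 < D ∧ 0 < κ ∧
      ∀ (Z X Y : ℝ) (M : ℕ) (s₀ : ℝ),
        2 ≤ Z → 1 ≤ X → X ≤ Y → Y ≤ c₁ * Z ^ (1 / (k : ℝ)) →
        Z ^ (1 / (k : ℝ)) / c₁ ≤ X * Y →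
        0 < M → (M : ℝ) ≤ Z →
        max ((9 / 2) * (1 + δ) * Real.log (Z / X ^ k) * Real.log Y / Real.log Z)
          (Real.log Y) ≤ Real.log M →
        0 ≤ s₀ → s₀ ≤ 2 * X / Y →
        ∃ (d e : ℕ) (B : MvPolynomial (Fin 4) ℤ),
          d ≤ D ∧ e ≤ D ∧ B ≠ 0 ∧
          (∀ m ∈ B.support, m 0 + m 1 = d ∧ m 2 + m 3 = e) ∧
          (∀ m ∈ B.support, ((|B.coeff m| : ℤ) : ℝ) ≤ Z ^ κ) ∧
          ∀ a b x y : ℕ, 0 < a → 0 < b → 0 < x → 0 < y →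
            (a : ℤ) * (x : ℤ) ^ k - (b : ℤ) * (y : ℤ) ^ k = 1 →
            X < (x : ℝ) → (x : ℝ) ≤ 2 * X → Y < (y : ℝ) → (y : ℝ) ≤ 2 * Y →
            Z < (b : ℝ) * (y : ℝ) ^ k → (b : ℝ) * (y : ℝ) ^ k ≤ 2 * Z →
            s₀ < (x : ℝ) / (y : ℝ) → (x : ℝ) / (y : ℝ) ≤ s₀ + 1 / (M : ℝ) →
            MvPolynomial.eval ![(a : ℤ), (b : ℤ), (x : ℤ), (y : ℤ)] B = 0 := by
  obtain ⟨D, V, Z₀, hlarge⟩ := exists_bihomogeneous_of_large k hk δ c₁ hδ hc₁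
  set n := ⌈2 * (c₁ * Z₀)⌉₊ with hn
  obtain ⟨e₀, c, ⟨γ₀, hγ₀, hcγ₀⟩, hvanish⟩ := exists_form_vanishing_on_box n
  set S := ∑ γ ∈ Finset.range (e₀ + 1), (c γ).natAbs with hS
  refine ⟨D + e₀ + 1, ⌈V⌉₊ + S + 1, by omega, by omega, ?_⟩
  intro Z X Y M s₀ hZ2 hX hXY hYZ hZXY hM hMZ hlog hs0 hs2
  have hZ1 : 1 ≤ Z := by linarith
  rcases le_total Z₀ Z with hZ | hZ
  · obtain ⟨d, e, B, hd, he, hB0, hBs, hBc, hBe⟩ :=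
      hlarge Z X Y M s₀ hZ hZ2 hX hXY hYZ hZXY hM hMZ hlog hs0 hs2
    refine ⟨d, e, B, by omega, by omega, hB0, hBs, fun m hm => (hBc m hm).trans ?_, hBe⟩
    rw [← Real.rpow_natCast]
    refine Real.rpow_le_rpow_of_exponent_le hZ1 ?_
    push_cast
    have := Nat.le_ceil V
    have : (0 : ℝ) ≤ S := Nat.cast_nonneg _
    linarith
  · obtain ⟨B, hB0, hBs, hBc, hBe⟩ := exists_bihomogeneous_of_coeffs 0 e₀ (fun _ γ => c γ)
      (Z ^ (⌈V⌉₊ + S + 1)) ⟨0, le_rfl, γ₀, hγ₀, hcγ₀⟩ (by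
        intro _ _ γ hγ
        have h1 : (c γ).natAbs ≤ S := Finset.single_le_sum (f := fun γ => (c γ).natAbs)
          (fun _ _ => Nat.zero_le _) (Finset.mem_range.mpr (Nat.lt_succ_of_le hγ))
        have h2 : (c γ).natAbs ≤ 2 ^ (⌈V⌉₊ + S + 1) :=
          (h1.trans (by omega)).trans (Nat.lt_two_pow_self (n := ⌈V⌉₊ + S + 1)).le
        rw [Int.abs_eq_natAbs]
        calc (((c γ).natAbs : ℤ) : ℝ) ≤ 2 ^ (⌈V⌉₊ + S + 1) := by exact_mod_cast h2
          _ ≤ _ := by gcongr)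
    refine ⟨0, e₀, B, by omega, by omega, hB0, hBs, hBc, ?_⟩
    intro a b x y ha _ hx hy _ _ hxX _ hyY _ _ _ _
    have hYn : 2 * Y ≤ n := by
      have h1 : Z ^ (1 / (k : ℝ)) ≤ Z := by
        refine Real.rpow_le_self_of_one_le hZ1 ?_
        rw [div_le_one (by positivity)]
        exact_mod_cast (by omega : 1 ≤ k)
      have h2 : c₁ * Z ^ (1 / (k : ℝ)) ≤ c₁ * Z₀ := by
        gcongr
        exact h1.trans hZ
      have h3 := Nat.le_ceil (2 * (c₁ * Z₀))
      linarith
    have hxn : x ≤ n := by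
      have : (x : ℝ) ≤ n := by linarith
      exact_mod_cast this
    have hyn : y ≤ n := by
      have : (y : ℝ) ≤ n := by linarith
      exact_mod_cast this
    have hsum := sum_bihomogeneous_eq 0 e₀ (fun _ γ => c γ) a b x y
      (by positivity) (by positivity)
    rw [hBe]
    have h0 : ((∑ β ∈ Finset.range (0 + 1), ∑ γ ∈ Finset.range (e₀ + 1),
        c γ * ((a : ℤ) ^ (0 - β) * (b : ℤ) ^ β * (x : ℤ) ^ γ * (y : ℤ) ^ (e₀ - γ)) : ℤ) : ℝ) =
          0 := by
      push_cast
      rw [hsum]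
      simp [hvanish x y hy hxn hyn]
    exact_mod_cast h0
end

section
/- Let ε > 0. There exists a constant C = C(ε) > 0 such that the following holds. Let Z ≥ 2 and let X, Y be reals and M a positive integer with 1 ≤ X ≤ Y ≤ M ≤ Z. Then for every real L ≥ 1, the number of integers z with 0 < z ≤ 2·M·X/Y such that there exists (x,y) ∈ ℤ², (x,y) ≠ (0,0), with (M·x − z·y)² + y² ≤ (2Y/L)² is at most C·Z^ε·( Y/L + X·Y/L² ). -/
theorem Nat.exists_card_divisors_le_mul_rpow {ε : ℝ} (hε : 0 < ε) :
    ∃ C : ℝ, 0 < C ∧ ∀ n : ℕ, (n.divisors.card : ℝ) ≤ C * (n : ℝ) ^ ε := by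
  have hlog : 0 < Real.log 2 := Real.log_pos one_lt_two
  set K : ℝ := 1 + 1 / (ε * Real.log 2) with hK
  have hK1 : 1 ≤ K := by
    have : 0 < 1 / (ε * Real.log 2) := by positivity
    linarith
  set N : ℕ := ⌈(2 : ℝ) ^ (1 / ε)⌉₊ with hN
  have small (p a : ℕ) (hp : 2 ≤ p) : (a : ℝ) + 1 ≤ K * ((p : ℝ) ^ a) ^ ε := by
    have h2 : 1 + a * (ε * Real.log 2) ≤ ((2 : ℝ) ^ a) ^ ε := by
      rw [← Real.rpow_natCast, ← Real.rpow_mul zero_le_two, Real.rpow_def_of_pos two_pos]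
      have := Real.add_one_le_exp (Real.log 2 * (a * ε))
      linarith
    have hp2 : ((2 : ℝ) ^ a) ^ ε ≤ ((p : ℝ) ^ a) ^ ε := by
      have : (2 : ℝ) ≤ p := by exact_mod_cast hp
      gcongr
    calc (a : ℝ) + 1 ≤ K * (1 + a * (ε * Real.log 2)) := by
          have hz : 0 ≤ 1 / (ε * Real.log 2) + a * (ε * Real.log 2) := by positivity
          have : K * (1 + a * (ε * Real.log 2))
              = 1 + a + (1 / (ε * Real.log 2) + a * (ε * Real.log 2)) := by
            rw [hK]; field_simp; ring
          linarith
      _ ≤ K * ((p : ℝ) ^ a) ^ ε := by gcongr; exact h2.trans hp2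
  have large (p a : ℕ) (hp : N ≤ p) : (a : ℝ) + 1 ≤ ((p : ℝ) ^ a) ^ ε := by
    have h1 : (2 : ℝ) ^ (1 / ε) ≤ p := Nat.ceil_le.mp hp
    have h2 : (2 : ℝ) ≤ (p : ℝ) ^ ε := by
      calc (2 : ℝ) = ((2 : ℝ) ^ (1 / ε)) ^ ε := by
            rw [← Real.rpow_mul zero_le_two, one_div_mul_cancel hε.ne', Real.rpow_one]
        _ ≤ (p : ℝ) ^ ε := by gcongr
    have h3 : (a : ℝ) + 1 ≤ 2 ^ a := by exact_mod_cast Nat.lt_two_pow_self (n := a)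
    calc (a : ℝ) + 1 ≤ 2 ^ a := h3
      _ ≤ ((p : ℝ) ^ ε) ^ a := by gcongr
      _ = ((p : ℝ) ^ a) ^ ε := by
        rw [← Real.rpow_natCast, ← Real.rpow_natCast, ← Real.rpow_mul (by positivity),
          ← Real.rpow_mul (by positivity), mul_comm]
  refine ⟨K ^ N, by positivity, fun n => ?_⟩
  rcases eq_or_ne n 0 with rfl | hn
  · simp [Real.zero_rpow hε.ne']
  have hprod : (n : ℝ) ^ ε = ∏ p ∈ n.primeFactors, ((p : ℝ) ^ n.factorization p) ^ ε := by
    rw [Real.finsetProd_rpow _ _ fun _ _ => by positivity]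
    congr 1
    exact_mod_cast (Nat.prod_factorization_pow_eq_self hn).symm
  rw [Nat.card_divisors hn, hprod]
  push_cast
  calc ∏ p ∈ n.primeFactors, ((n.factorization p : ℝ) + 1)
      ≤ ∏ p ∈ n.primeFactors,
          ((if p < N then K else 1) * ((p : ℝ) ^ n.factorization p) ^ ε) := by
        refine Finset.prod_le_prod (fun _ _ => by positivity) fun p hp => ?_
        split_ifs with h
        · exact small p _ (Nat.prime_of_mem_primeFactors hp).two_le
        · simpa using large p (n.factorization p) (not_lt.mp h)
    _ = K ^ (n.primeFactors.filter (· < N)).card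
          * ∏ p ∈ n.primeFactors, ((p : ℝ) ^ n.factorization p) ^ ε := by
        rw [Finset.prod_mul_distrib, Finset.prod_ite]
        simp
    _ ≤ _ := by
        gcongr
        calc (n.primeFactors.filter (· < N)).card ≤ (Finset.range N).card :=
              Finset.card_le_card fun p hp => by simpa using (Finset.mem_filter.mp hp).2
          _ = N := Finset.card_range N

theorem Int.card_Icc_neg_floor_le {a : ℝ} (ha : 0 ≤ a) :
    ((Finset.Icc (-⌊a⌋) ⌊a⌋).card : ℝ) ≤ 2 * a + 1 := by
  have h0 : 0 ≤ ⌊a⌋ := Int.floor_nonneg.mpr ha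
  have h : ((Finset.Icc (-⌊a⌋) ⌊a⌋).card : ℤ) = 2 * ⌊a⌋ + 1 := by
    rw [Int.card_Icc]; lia
  have h' : ((Finset.Icc (-⌊a⌋) ⌊a⌋).card : ℝ) = 2 * ⌊a⌋ + 1 := by exact_mod_cast h
  have := Int.floor_le a
  linarith

theorem Int.mem_Icc_neg_floor {a : ℝ} {n : ℤ} (h : |(n : ℝ)| ≤ a) :
    n ∈ Finset.Icc (-⌊a⌋) ⌊a⌋ := by
  obtain ⟨h1, h2⟩ := abs_le.mp h
  rw [Finset.mem_Icc]
  refine ⟨neg_le.mp (Int.le_floor.mpr ?_), Int.le_floor.mpr h2⟩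
  push_cast
  linarith

theorem Int.abs_le_of_mem_Icc_neg_floor {a : ℝ} {n : ℤ}
    (h : n ∈ Finset.Icc (-⌊a⌋) ⌊a⌋) : |(n : ℝ)| ≤ a := by
  obtain ⟨h1, h2⟩ := Finset.mem_Icc.mp h
  have h3 := Int.le_floor.mp h2
  have h4 := Int.le_floor.mp (neg_le.mp h1)
  push_cast at h4
  exact abs_le.mpr ⟨by linarith, h3⟩

/-- If every element `z` of `S` divides a positive integer of the form `m * x + w` with `|x| ≤ A`
and `|w| ≤ B`, then `S` is controlled by the number of pairs `(x, w)` and the number of divisors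
of each `m * x + w`. -/
theorem Int.ncard_le_of_forall_dvd {S : Set ℤ} {m : ℕ} {A B D : ℝ}
    (hA : 0 ≤ A) (hB : 0 ≤ B)
    (hD : ∀ n : ℕ, (n : ℝ) ≤ m * A + B → (n.divisors.card : ℝ) ≤ D)
    (hS : ∀ z ∈ S, 0 < z ∧ ∃ x w : ℤ, |(x : ℝ)| ≤ A ∧ |(w : ℝ)| ≤ B ∧
      0 < m * x + w ∧ z ∣ m * x + w) :
    (S.ncard : ℝ) ≤ (2 * A + 1) * (2 * B + 1) * D := by
  classical
  set P := Finset.Icc (-⌊A⌋) ⌊A⌋ ×ˢ Finset.Icc (-⌊B⌋) ⌊B⌋ with hP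
  set f : ℤ × ℤ → Finset ℤ :=
    fun q => (m * q.1 + q.2).toNat.divisors.image (fun d : ℕ => (d : ℤ)) with hf
  have hD0 : 0 ≤ D := by
    simpa using hD 0 (by push_cast; positivity)
  have hsub : S ⊆ (P.biUnion f : Finset ℤ) := by
    intro z hz
    obtain ⟨hz0, x, w, hx, hw, hpos, hdvd⟩ := hS z hz
    rw [Finset.mem_coe, Finset.mem_biUnion]
    refine ⟨(x, w), Finset.mem_product.mpr
      ⟨Int.mem_Icc_neg_floor hx, Int.mem_Icc_neg_floor hw⟩, ?_⟩
    rw [hf, Finset.mem_image]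
    refine ⟨z.toNat, Nat.mem_divisors.mpr ⟨?_, ?_⟩, Int.toNat_of_nonneg hz0.le⟩
    · rw [← Int.natCast_dvd_natCast, Int.toNat_of_nonneg hz0.le, Int.toNat_of_nonneg hpos.le]
      exact hdvd
    · dsimp only
      lia
  have hcard (q : ℤ × ℤ) (hq : q ∈ P) : ((f q).card : ℝ) ≤ D := by
    obtain ⟨hx, hw⟩ := Finset.mem_product.mp hq
    have hx' := (abs_le.mp (Int.abs_le_of_mem_Icc_neg_floor hx)).2
    have hw' := (abs_le.mp (Int.abs_le_of_mem_Icc_neg_floor hw)).2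
    refine (Nat.cast_le.mpr Finset.card_image_le).trans (hD _ ?_)
    rcases le_total (m * q.1 + q.2) 0 with h | h
    · rw [Int.toNat_of_nonpos h]
      push_cast
      positivity
    · have : (((m * q.1 + q.2).toNat : ℤ) : ℝ) = m * q.1 + q.2 := by
        rw [Int.toNat_of_nonneg h]; push_cast; rfl
      rw [Int.cast_natCast] at this
      rw [this]
      gcongr
  calc (S.ncard : ℝ) ≤ ((P.biUnion f).card : ℝ) := by
        exact_mod_cast (Set.ncard_le_ncard hsub (Finset.finite_toSet _)).trans_eq
          (Set.ncard_coe_finset _)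
    _ ≤ ∑ q ∈ P, ((f q).card : ℝ) := by exact_mod_cast Finset.card_biUnion_le
    _ ≤ P.card * D := by
        simpa using Finset.sum_le_card_nsmul P (fun q => ((f q).card : ℝ)) D hcard
    _ ≤ _ := by
        rw [hP, Finset.card_product]
        push_cast
        gcongr
        · exact Int.card_Icc_neg_floor_le hA
        · exact Int.card_Icc_neg_floor_le hB

theorem stmt_9 (ε : ℝ) (hε : 0 < ε) :
    ∃ C : ℝ, 0 < C ∧ ∀ (Z X Y : ℝ) (M : ℕ) (L : ℝ),
      2 ≤ Z → 0 < M → 1 ≤ X → X ≤ Y → (Y : ℝ) ≤ M → (M : ℝ) ≤ Z → 1 ≤ L →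
      ({z : ℤ | 0 < z ∧ (z : ℝ) ≤ 2 * M * X / Y ∧
          ∃ x y : ℤ, ¬(x = 0 ∧ y = 0) ∧
            ((M : ℝ) * (x : ℝ) - (z : ℝ) * (y : ℝ)) ^ 2 + (y : ℝ) ^ 2
              ≤ (2 * Y / L) ^ 2}.ncard : ℝ)
        ≤ C * Z ^ ε * (Y / L + X * Y / L ^ 2) := by
  obtain ⟨C, hC, hdiv⟩ := Nat.exists_card_divisors_le_mul_rpow (half_pos hε)
  refine ⟨72 * C * 8 ^ (ε / 2) + 4, by positivity, ?_⟩
  intro Z X Y M L hZ hM hX hXY hYM hMZ hL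
  have hM0 : (0 : ℝ) < M := by exact_mod_cast hM
  have hY : 0 < Y := by linarith
  have hL0 : 0 < L := by linarith
  have hZε : 1 ≤ Z ^ ε := Real.one_le_rpow (by linarith) hε.le
  have hYL : 0 < Y / L := by positivity
  have hK : 0 < 2 * Y / L := by positivity
  set K := 2 * Y / L with hKdef
  set S := {z : ℤ | 0 < z ∧ (z : ℝ) ≤ 2 * M * X / Y ∧
          ∃ x y : ℤ, ¬(x = 0 ∧ y = 0) ∧
            ((M : ℝ) * (x : ℝ) - (z : ℝ) * (y : ℝ)) ^ 2 + (y : ℝ) ^ 2 ≤ K ^ 2} with hS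
  rcases le_or_gt (M : ℝ) K with hMK | hKM
  · have hsub : S ⊆ (Finset.Icc (1 : ℤ) (2 * M) : Finset ℤ) := by
      rintro z ⟨hz0, hz, -⟩
      have h : (z : ℝ) ≤ 2 * M := by
        refine hz.trans ((div_le_iff₀ hY).mpr ?_)
        gcongr
      rw [Finset.mem_coe, Finset.mem_Icc]
      exact ⟨hz0, by exact_mod_cast h⟩
    have hcard : (S.ncard : ℝ) ≤ 2 * M := by
      have := (Set.ncard_le_ncard hsub (Finset.finite_toSet _)).trans_eq (Set.ncard_coe_finset _)
      rw [Int.card_Icc] at this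
      have h' : S.ncard ≤ 2 * M := by lia
      exact_mod_cast h'
    calc (S.ncard : ℝ) ≤ 2 * K := by linarith
      _ = 4 * 1 * (Y / L + 0) := by rw [hKdef]; ring
      _ ≤ _ := by
        gcongr
        · have : 0 ≤ 72 * C * 8 ^ (ε / 2) := by positivity
          linarith
        · positivity
  rcases lt_or_ge K 1 with hK1 | hK1
  · have hempty : S = ∅ := by
      rw [Set.eq_empty_iff_forall_notMem]
      rintro z ⟨-, -, x, y, hxy, h⟩
      have hy : |(y : ℝ)| ≤ K := abs_le_of_sq_le_sq (by nlinarith) hK.le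
      have hy0 : y = 0 := by
        have : |(y : ℝ)| < 1 := hy.trans_lt hK1
        exact Int.abs_lt_one_iff.mp (by exact_mod_cast this)
      subst hy0
      have hx : |(M : ℝ) * x| ≤ K := abs_le_of_sq_le_sq (by simpa using h) hK.le
      have hx0 : x ≠ 0 := fun h0 => hxy ⟨h0, rfl⟩
      have hx1 : (1 : ℝ) ≤ |(x : ℝ)| := by exact_mod_cast Int.one_le_abs hx0
      rw [abs_mul, abs_of_pos hM0] at hx
      nlinarith
    rw [hempty, Set.ncard_empty, Nat.cast_zero]
    positivity
  have hKM' : K ≤ 2 * M / L := by rw [hKdef]; gcongr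
  have hxb (x : ℤ) (h : |(M : ℝ) * x| ≤ 4 * M * X / L + K) : |(x : ℝ)| ≤ 6 * X / L := by
    rw [abs_mul, abs_of_pos hM0] at h
    refine le_of_mul_le_mul_left (h.trans ?_) hM0
    calc 4 * M * X / L + K ≤ 4 * M * X / L + 2 * (M * X) / L := by
          refine add_le_add_right (hKM'.trans ?_) _
          gcongr
          nlinarith
      _ = M * (6 * X / L) := by ring
  have key (z x y : ℤ) (hz0 : 0 < z) (hz : (z : ℝ) ≤ 2 * M * X / Y) (hy0 : 0 < y)
      (h : ((M : ℝ) * x - z * y) ^ 2 + (y : ℝ) ^ 2 ≤ K ^ 2) :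
      ∃ x w : ℤ, |(x : ℝ)| ≤ 6 * X / L ∧ |(w : ℝ)| ≤ K ∧ 0 < M * x + w ∧ z ∣ M * x + w := by
    have heq : M * x + (z * y - M * x) = z * y := by ring
    have hyK : (y : ℝ) ≤ K := (abs_le_of_sq_le_sq' (by nlinarith) hK.le).2
    have hw := abs_le_of_sq_le_sq (a := (M : ℝ) * x - z * y) (by nlinarith) hK.le
    have hy' : (0 : ℝ) < y := by exact_mod_cast hy0
    have hz' : (0 : ℝ) < z := by exact_mod_cast hz0
    have hzy : (z : ℝ) * y ≤ 4 * M * X / L := by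
      calc (z : ℝ) * y ≤ (2 * M * X / Y) * K := by gcongr
        _ = 4 * M * X / L := by rw [hKdef]; field_simp; ring
    refine ⟨x, z * y - M * x, hxb x ?_, ?_, ?_, ?_⟩
    · have hp := mul_pos hz' hy'
      obtain ⟨h1, h2⟩ := abs_le.mp hw
      exact abs_le.mpr ⟨by linarith, by linarith⟩
    · push_cast
      rwa [abs_sub_comm]
    · rw [heq]; positivity
    · rw [heq]; exact dvd_mul_right z y
  have hcount : (S.ncard : ℝ) ≤
      (2 * (6 * X / L) + 1) * (2 * K + 1) * (C * (8 ^ (ε / 2) * Z ^ ε)) := by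
    refine Int.ncard_le_of_forall_dvd (m := M) (by positivity) hK.le ?_ ?_
    · intro n hn
      refine (hdiv n).trans ?_
      have hn8 : (n : ℝ) ≤ 8 * Z ^ 2 := by
        have h1 : M * (6 * X / L) ≤ Z * (6 * Z) := by
          gcongr
          exact (div_le_self (by positivity) hL).trans (by linarith)
        nlinarith
      have : (8 * Z ^ 2) ^ (ε / 2) = 8 ^ (ε / 2) * Z ^ ε := by
        rw [Real.mul_rpow (by positivity) (by positivity), ← Real.rpow_natCast Z 2,
          ← Real.rpow_mul (by linarith)]
        congr 2
        push_cast
        ring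
      rw [← this]
      gcongr
    · rintro z ⟨hz0, hz, x, y, hxy, h⟩
      refine ⟨hz0, ?_⟩
      rcases lt_trichotomy y 0 with hy | hy | hy
      · refine key z (-x) (-y) hz0 hz (by lia) ?_
        push_cast
        convert h using 1
        ring
      · subst hy
        have hx : |(M : ℝ) * x| ≤ K := abs_le_of_sq_le_sq (by simpa using h) hK.le
        have hx0 : x ≠ 0 := fun h0 => hxy ⟨h0, rfl⟩
        have hx1 : (1 : ℝ) ≤ |(x : ℝ)| := by exact_mod_cast Int.one_le_abs hx0
        rw [abs_mul, abs_of_pos hM0] at hx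
        nlinarith
      · exact key z x y hz0 hz hy h
  calc (S.ncard : ℝ)
      ≤ (2 * (6 * X / L) + 1) * (2 * K + 1) * (C * (8 ^ (ε / 2) * Z ^ ε)) := hcount
    _ ≤ (2 * (6 * X / L) + 12) * (3 * K) * (C * (8 ^ (ε / 2) * Z ^ ε)) := by
        gcongr
        · norm_num
        · linarith
    _ = (72 * C * 8 ^ (ε / 2)) * Z ^ ε * (Y / L + X * Y / L ^ 2) := by
        rw [hKdef]; field_simp; ring
    _ ≤ _ := by gcongr; linarith
end
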